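/- arXiv:2305.11677 — 2 statements merged into one kernel-verified Lean document; each statement's English description precedes it below -/
import Mathlib

section
/- Let q be an even prime power (a power of 2), let m ≡ 2 (mod 4) with m ≥ 6, and let n = q^m + 1. Set δ_2 = q(q-1)(q^m - 2q^{m-4} - 1)/(2(q^2+1)), and set δ_3 = δ_2 - (q-1)q^2 if m = 6 and δ_3 = δ_2 - q(q-1)(q^2-1) if m > 6. Then δ_2 and δ_3 are, respectively, the second and third largest coset leaders modulo n, i.e. δ_{2,n} = δ_2 and δ_{3,n} = δ_3. Moreover, the q-cyclotomic cosets of δ_2 and of δ_3 modulo n each have exactly 2m elements. -/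
/-- The `q`-cyclotomic coset of `s` modulo `n`:
`C_s = { s·q^j mod n : 0 ≤ j ≤ ord_n(q) - 1 }`. -/
noncomputable def cycCoset (q n s : ℕ) : Finset ℕ :=
  (Finset.range (orderOf (q : ZMod n))).image fun j => s * q ^ j % n

/-- `s` is a coset leader modulo `n` iff `s = min C_s`. -/
def IsCosetLeader (q n s : ℕ) : Prop :=
  s ∈ cycCoset q n s ∧ ∀ x ∈ cycCoset q n s, s ≤ x

/-- The set of coset leaders modulo `n` (as a finset of `{0, …, n-1}`). -/
noncomputable def cosetLeaders (q n : ℕ) : Finset ℕ :=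
  (Finset.range n).filter fun s => s ∈ cycCoset q n s ∧ ∀ x ∈ cycCoset q n s, s ≤ x

/-- The `i`-th largest coset leader modulo `n` (for `i ≥ 1`), i.e. `δ_{i,n}`. -/
noncomputable def nthLargestCosetLeader (q n i : ℕ) : ℕ :=
  (((cosetLeaders q n).sort (· ≤ ·)).reverse).getD (i - 1) 0

/-- The `j`-th element of the orbit of `s`. -/
def rr (q n s j : ℕ) : ℕ := s * q ^ j % n

/-- The `j`-th digit of `s / n` in base `q`. -/
def dd (q n s j : ℕ) : ℕ := q * rr q n s j / n

lemma rr_succ (q n s j : ℕ) : rr q n s (j + 1) = (q * rr q n s j) % n := by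
  unfold rr
  rw [pow_succ, ← mul_assoc, mul_comm _ q, Nat.mul_mod q (s * q ^ j), Nat.mul_mod q (s * q ^ j % n),
    Nat.mod_mod]

lemma rr_step (q n s j : ℕ) :
    q * rr q n s j = n * dd q n s j + rr q n s (j + 1) := by
  rw [rr_succ]; unfold dd
  exact (Nat.div_add_mod _ _).symm

lemma rr_lt {n : ℕ} (hn : 0 < n) (q s j : ℕ) : rr q n s j < n := Nat.mod_lt _ hn

lemma rr_zero {q n s : ℕ} (hs : s < n) : rr q n s 0 = s := by
  simp [rr, Nat.mod_eq_of_lt hs]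

lemma lex_lt {q n : ℕ} (hn : 0 < n) (t : ℕ) : ∀ (s s' i i' : ℕ),
    (∀ u < t, dd q n s (i + u) = dd q n s' (i' + u)) →
    dd q n s (i + t) < dd q n s' (i' + t) → rr q n s i < rr q n s' i' := by
  induction t with
  | zero =>
    intro s s' i i' _ h
    have h1 := rr_step q n s i
    have h2 := rr_step q n s' i'
    have h3 := rr_lt hn q s (i + 1)
    simp only [Nat.add_zero] at h
    have h4 : n * (dd q n s i + 1) ≤ n * dd q n s' i' := Nat.mul_le_mul_left _ h
    have h5 : q * rr q n s i < q * rr q n s' i' := by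
      rw [Nat.mul_add] at h4
      omega
    exact lt_of_mul_lt_mul_left h5 (Nat.zero_le q)
  | succ t ih =>
    intro s s' i i' h0 h
    have h1 := rr_step q n s i
    have h2 := rr_step q n s' i'
    have h3 : dd q n s i = dd q n s' i' := h0 0 (by omega)
    have h4 : rr q n s (i + 1) < rr q n s' (i' + 1) := by
      apply ih
      · intro u hu
        have := h0 (u + 1) (by omega)
        rw [show i + 1 + u = i + (u + 1) by ring, show i' + 1 + u = i' + (u + 1) by ring]
        exact this
      · rw [show i + 1 + t = i + (t + 1) by ring, show i' + 1 + t = i' + (t + 1) by ring]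
        exact h
    have h5 : q * rr q n s i < q * rr q n s' i' := by
      rw [h3] at h1
      omega
    exact lt_of_mul_lt_mul_left h5 (Nat.zero_le q)

lemma agree {q n : ℕ} (t : ℕ) : ∀ (s s' i i' : ℕ),
    (∀ u < t, dd q n s (i + u) = dd q n s' (i' + u)) →
    q ^ t * rr q n s i + rr q n s' (i' + t) = q ^ t * rr q n s' i' + rr q n s (i + t) := by
  induction t with
  | zero => intro s s' i i' _; simp; ring
  | succ t ih =>
    intro s s' i i' h0
    have h1 := rr_step q n s (i + t)
    have h2 := rr_step q n s' (i' + t)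
    have h3 := h0 t (by omega)
    have h4 := ih s s' i i' (fun u hu => h0 u (by omega))
    rw [h3] at h1
    have h5 : q * (q ^ t * rr q n s i + rr q n s' (i' + t))
      = q * (q ^ t * rr q n s' i' + rr q n s (i + t)) := by rw [h4]
    rw [Nat.mul_add, Nat.mul_add, h1, h2] at h5
    rw [pow_succ', mul_assoc, mul_assoc, ← add_assoc, ← add_assoc]
    omega

lemma rr_anti {q m n s : ℕ} (hn : n = q ^ m + 1) (hm : 0 < m) (hs0 : 0 < s) (hs : s < n) (j : ℕ) :
    rr q n s (j + m) + rr q n s j = n := by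
  have hn0 : 0 < n := by omega
  have hcop : Nat.Coprime n q := by
    have h : Nat.Coprime n (q ^ m) := by rw [hn]; simp
    exact Nat.Coprime.coprime_dvd_right (dvd_pow_self q (by omega)) h
  have hpos : 0 < rr q n s j := by
    rcases Nat.eq_zero_or_pos (rr q n s j) with h | h
    · exfalso
      have h1 : n ∣ s * q ^ j := Nat.dvd_of_mod_eq_zero h
      have h2 : n ∣ s := (Nat.Coprime.pow_right j hcop).dvd_of_dvd_mul_right h1
      exact absurd (Nat.le_of_dvd hs0 h2) (by omega)
    · exact h
  have hd : n ∣ rr q n s (j + m) + rr q n s j := by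
    have : (s * q ^ (j + m) + s * q ^ j) % n = 0 := by
      have : s * q ^ (j + m) + s * q ^ j = n * (s * q ^ j) := by rw [hn, pow_add]; ring
      rw [this]; simp
    unfold rr
    rw [Nat.add_mod] at this
    exact Nat.dvd_of_mod_eq_zero this
  have h1 := rr_lt hn0 q s (j + m)
  have h2 := rr_lt hn0 q s j
  obtain ⟨c, hc⟩ := hd
  have hc2 : c < 2 := by
    by_contra hh
    have : n * 2 ≤ n * c := Nat.mul_le_mul_left _ (by omega)
    omega
  have hc0 : c ≠ 0 := by rintro rfl; omega
  have : c = 1 := by omega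
  subst this; omega

lemma rr_eq {q m n s s' : ℕ} (hn : n = q ^ m + 1) (hm : 0 < m) (hs0 : 0 < s) (hs : s < n)
    (hs0' : 0 < s') (hs' : s' < n) (i i' : ℕ)
    (h : ∀ u < m, dd q n s (i + u) = dd q n s' (i' + u)) : rr q n s i = rr q n s' i' := by
  have h1 := agree m s s' i i' h
  have h2 := rr_anti hn hm hs0 hs i
  have h3 := rr_anti hn hm hs0' hs' i'
  have h4 : n * rr q n s i = n * rr q n s' i' := by
    rw [hn] at *
    rw [add_mul, add_mul, one_mul, one_mul]; omega
  exact Nat.eq_of_mul_eq_mul_left (by omega) h4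

lemma dd_anti {q m n s : ℕ} (hn : n = q ^ m + 1) (hm : 0 < m) (hs0 : 0 < s) (hs : s < n) (j : ℕ) :
    dd q n s (j + m) + dd q n s j + 1 = q := by
  have hn0 : 0 < n := by omega
  have h1 := rr_step q n s (j + m)
  have h2 := rr_step q n s j
  have h3 := rr_anti hn hm hs0 hs j
  have h4 := rr_anti hn hm hs0 hs (j + 1)
  rw [show j + 1 + m = j + m + 1 by ring] at h4
  have h5 : n * q = n * (dd q n s (j + m) + dd q n s j + 1) := by
    calc n * q = q * (rr q n s (j + m) + rr q n s j) := by rw [h3]; ring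
      _ = _ := by rw [mul_add, h1, h2]; nlinarith
  exact (Nat.eq_of_mul_eq_mul_left hn0 h5).symm

/-- partial digit sums -/
def AA (q : ℕ) (D : ℕ → ℕ) : ℕ → ℕ → ℕ
  | 0, _ => 0
  | l + 1, j => q * AA q D l j + D (j + l)

lemma AA_succ' (q : ℕ) (D : ℕ → ℕ) (l : ℕ) : ∀ j, AA q D (l + 1) j = D j * q ^ l + AA q D l (j + 1) := by
  induction l with
  | zero => intro j; simp [AA]
  | succ l ih =>
    intro j
    rw [AA, ih, AA, show j + 1 + l = j + (l + 1) by ring, pow_succ]; ring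

lemma AA_lt {q : ℕ} (D : ℕ → ℕ) (hD : ∀ j, D j < q) (l j : ℕ) : AA q D l j < q ^ l := by
  induction l with
  | zero => simp [AA]
  | succ l ih =>
    rw [AA, pow_succ]
    have := hD (j + l)
    nlinarith

lemma word_seed {q m n : ℕ} (hn : n = q ^ m + 1) (D : ℕ → ℕ)
    (hD : ∀ j, D (j + m) + D j + 1 = q) (j : ℕ) : dd q n (1 + AA q D m 0) j = D j := by
  have hDq : ∀ j, D j < q := fun j => by have := hD j; omega
  have hstep : ∀ j, q * (1 + AA q D m j) = n * D j + (1 + AA q D m (j + 1)) := by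
    intro j
    have h1 : AA q D (m + 1) j = q * AA q D m j + D (j + m) := rfl
    have h2 := AA_succ' q D m j
    have h3 := hD j
    rw [hn]
    nlinarith
  have hlt : ∀ j, 1 + AA q D m j < n := fun j => by
    have := AA_lt D hDq m j
    omega
  have hr : ∀ j, rr q n (1 + AA q D m 0) j = 1 + AA q D m j := by
    intro j
    induction j with
    | zero => exact rr_zero (hlt 0)
    | succ j ih =>
      rw [rr_succ, ih, hstep, Nat.mul_add_mod, Nat.mod_eq_of_lt (hlt _)]
  unfold dd
  rw [hr, hstep, Nat.mul_add_div (by omega), Nat.div_eq_of_lt (hlt _)]; rfl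

lemma order_q {q m n : ℕ} (hq : 2 ≤ q) (hm : 0 < m) (hn : n = q ^ m + 1) :
    orderOf (q : ZMod n) = 2 * m := by
  have hqm : (q : ZMod n) ^ m = -1 := by
    have : ((q ^ m + 1 : ℕ) : ZMod n) = 0 := by rw [← hn]; exact ZMod.natCast_self n
    push_cast at this
    exact eq_neg_of_add_eq_zero_left this
  have hq1 : 2 ≤ q ^ m := le_trans hq (Nat.le_self_pow (by omega) q)
  rw [orderOf_eq_iff (by omega)]
  refine ⟨by rw [mul_comm, pow_mul, hqm]; norm_num, ?_⟩
  intro j hj hj0 h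
  rcases lt_or_ge j m with hjm | hjm
  · have h1 : ((q ^ j : ℕ) : ZMod n) = ((1 : ℕ) : ZMod n) := by push_cast; exact h
    rw [ZMod.natCast_eq_natCast_iff'] at h1
    have h2 : q ^ j < q ^ m := Nat.pow_lt_pow_right (by omega) hjm
    rw [Nat.mod_eq_of_lt (by omega), Nat.mod_eq_of_lt (by omega)] at h1
    have : 1 < q ^ j := Nat.one_lt_pow (by omega) (by omega)
    omega
  · obtain ⟨i, rfl⟩ := Nat.exists_eq_add_of_le hjm
    rw [pow_add, hqm] at h
    have h1 : ((q ^ i + 1 : ℕ) : ZMod n) = 0 := by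
      push_cast
      have : (q : ZMod n) ^ i = -1 := by
        rw [neg_one_mul] at h
        linear_combination -h
      rw [this]; ring
    rw [ZMod.natCast_eq_zero_iff] at h1
    have h2 : q ^ i < q ^ m := Nat.pow_lt_pow_right (by omega) (by omega)
    have := Nat.le_of_dvd (by omega) h1
    omega

lemma rr_period {q m n s : ℕ} (hn : n = q ^ m + 1) (hm : 0 < m) (hs0 : 0 < s) (hs : s < n) (j : ℕ) :
    rr q n s (j + 2 * m) = rr q n s j := by
  have h1 := rr_anti hn hm hs0 hs j
  have h2 := rr_anti hn hm hs0 hs (j + m)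
  rw [show j + m + m = j + 2 * m by ring] at h2
  omega

lemma mem_leaders {q m n s : ℕ} (hq : 2 ≤ q) (hm : 0 < m) (hn : n = q ^ m + 1) (hs0 : 0 < s)
    (hs : s < n) : s ∈ cosetLeaders q n ↔ ∀ j, s ≤ rr q n s j := by
  have hper : ∀ k j, rr q n s (j + 2 * m * k) = rr q n s j := by
    intro k
    induction k with
    | zero => intro j; simp
    | succ k ih =>
      intro j
      rw [show j + 2 * m * (k + 1) = j + 2 * m * k + 2 * m by ring, rr_period hn hm hs0 hs, ih]
  have hz := rr_zero (q := q) hs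
  unfold rr at hz
  rw [cosetLeaders, Finset.mem_filter]
  simp only [Finset.mem_range, cycCoset, Finset.mem_image, order_q hq hm hn]
  constructor
  · rintro ⟨_, _, h⟩ j
    have h1 := hper (j / (2 * m)) (j % (2 * m))
    rw [Nat.mod_add_div] at h1
    rw [h1]
    exact h _ ⟨j % (2 * m), Nat.mod_lt _ (by omega), rfl⟩
  · intro h
    refine ⟨hs, ⟨0, by omega, hz⟩, ?_⟩
    rintro x ⟨j, _, rfl⟩
    exact h j

lemma card_coset {q m n s : ℕ} (hq : 2 ≤ q) (hm : 0 < m) (hn : n = q ^ m + 1) (hs0 : 0 < s)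
    (hs : s < n) (h : ∀ j, 0 < j → j < 2 * m → s < rr q n s j) :
    (cycCoset q n s).card = 2 * m := by
  unfold cycCoset
  rw [order_q hq hm hn, Finset.card_image_of_injOn, Finset.card_range]
  have hshift : ∀ k i j, rr q n s i = rr q n s j → rr q n s (i + k) = rr q n s (j + k) := by
    intro k i j hij
    induction k with
    | zero => exact hij
    | succ k ih => rw [← add_assoc, ← add_assoc, rr_succ, rr_succ, ih]
  have key : ∀ i j, i < j → j < 2 * m → rr q n s i ≠ rr q n s j := by
    intro i j hij hj he
    have h1 := hshift (2 * m - i) i j he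
    rw [show i + (2 * m - i) = 0 + 2 * m by omega, show j + (2 * m - i) = (j - i) + 2 * m by omega,
      rr_period hn hm hs0 hs, rr_period hn hm hs0 hs, rr_zero hs] at h1
    have := h (j - i) (by omega) (by omega)
    omega
  intro i hi j hj he
  simp only [Finset.coe_range, Set.mem_Iio] at hi hj
  rcases lt_trichotomy i j with h1 | h1 | h1
  · exact absurd he (key i j h1 hj)
  · exact h1
  · exact absurd he.symm (key j i h1 hi)

lemma sort_top3 (S : Finset ℕ) (a b c : ℕ) (ha : a ∈ S) (hb : b ∈ S) (hc : c ∈ S) (hab : b < a)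
    (hbc : c < b) (h : ∀ x ∈ S, c < x → x = a ∨ x = b) :
    ∃ L, (S.sort (· ≤ ·)).reverse = a :: b :: c :: L := by
  refine ⟨((S.filter (· < c)).sort (· ≤ ·)).reverse, ?_⟩
  rw [List.reverse_eq_iff]
  refine List.Perm.eq_of_pairwise' (r := (· ≤ ·)) (Finset.pairwise_sort _ _) ?_ ?_
  · rw [List.pairwise_reverse]
    simp only [List.pairwise_cons, List.mem_cons, List.mem_reverse, Finset.mem_sort,
      Finset.mem_filter]
    refine ⟨?_, ?_, ?_, ?_⟩
    · rintro x (rfl | rfl | ⟨_, _⟩) <;> omega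
    · rintro x (rfl | ⟨_, _⟩) <;> omega
    · rintro x ⟨_, _⟩; omega
    · rw [List.pairwise_reverse]; exact Finset.pairwise_sort _ _
  · rw [List.perm_ext_iff_of_nodup (Finset.sort_nodup _ _)]
    · intro x
      simp only [Finset.mem_sort, List.mem_reverse, List.mem_cons, Finset.mem_filter]
      constructor
      · intro hx
        rcases lt_trichotomy x c with h1 | h1 | h1
        · exact Or.inr (Or.inr (Or.inr ⟨hx, h1⟩))
        · exact Or.inr (Or.inr (Or.inl h1))
        · rcases h x hx h1 with h2 | h2
          · exact Or.inl h2
          · exact Or.inr (Or.inl h2)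
      · rintro (rfl | rfl | rfl | ⟨h1, _⟩) <;> assumption
    · rw [List.nodup_reverse]
      simp only [List.nodup_cons, List.mem_cons, List.mem_reverse, Finset.mem_sort,
        Finset.mem_filter, List.nodup_reverse]
      refine ⟨?_, ?_, ?_, Finset.sort_nodup _ _⟩
      · rintro (h1 | h1 | h1) <;> omega
      · rintro (h1 | h1) <;> omega
      · rintro h1; omega

/-- Minimal antiperiodic binary words. -/
structure MinWord (m : ℕ) (b : ℕ → ℕ) : Prop where
  hb : ∀ j, b j = 0 ∨ b j = 1
  ha : ∀ j, b (j + m) + b j = 1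
  hl : ∀ i t, (∀ u < t, b (i + u) = b u) → b t ≤ b (i + t)

namespace MinWord
variable {m : ℕ} {b : ℕ → ℕ}

lemma hc (H : MinWord m b) (i t : ℕ) (h : ∀ u < t, b (i + u) + b u = 1) : b t + b (i + t) ≤ 1 := by
  have h1 := H.hl (i + m) t (fun u hu => by
    have h1 := h u hu
    have h2 := H.ha (i + u)
    rw [show i + m + u = i + u + m by ring]; omega)
  have h2 := H.ha (i + t)
  rw [show i + m + t = i + t + m by ring] at h1
  omega

lemma start (H : MinWord m b) (hm : m % 2 = 0) : b 0 = 0 ∧ b 1 = 0 := by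
  have h0 : b 0 = 0 := by
    have h1 := H.hl m 0 (by simp)
    have h2 := H.ha 0
    simp only [Nat.add_zero, Nat.zero_add] at h1 h2
    have := H.hb 0
    omega
  refine ⟨h0, ?_⟩
  rcases H.hb 1 with h1 | h1
  · exact h1
  · exfalso
    have hs : ∀ j, b j + b (j + 1) = 1 := by
      intro j
      rcases H.hb j with hj | hj
      · have := H.hl j 1 (fun u hu => by
          obtain rfl : u = 0 := by omega
          simp; omega)
        have := H.hb (j + 1)
        omega
      · have := H.hc j 1 (fun u hu => by
          obtain rfl : u = 0 := by omega
          simp; omega)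
        omega
    have hp : ∀ k, b (2 * k) = 0 := by
      intro k
      induction k with
      | zero => exact h0
      | succ k ih =>
        have h2 := hs (2 * k)
        have h3 := hs (2 * k + 1)
        rw [show 2 * (k + 1) = 2 * k + 1 + 1 by ring]
        omega
    have h2 := hp (m / 2)
    have h3 := H.ha 0
    rw [show 2 * (m / 2) = m by omega] at h2
    simp only [Nat.zero_add] at h3
    omega

lemma nocube (H : MinWord m b) (h0 : b 0 = 0) (h1 : b 1 = 0) (h2 : b 2 = 1) (j : ℕ) :
    (b j = b (j + 1) → b (j + 2) + b (j + 1) = 1) := by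
  intro hj
  have hh := H.hb (j + 2)
  rcases H.hb j with h | h
  · have := H.hl j 2 (fun u hu => by interval_cases u <;> (try simp only [Nat.add_zero]) <;> omega)
    omega
  · have := H.hc j 2 (fun u hu => by interval_cases u <;> (try simp only [Nat.add_zero]) <;> omega)
    omega

lemma case1 (H : MinWord m b) (h0 : b 0 = 0) (h1 : b 1 = 0) (h2 : b 2 = 1) (h3 : b 3 = 1) (j : ℕ) :
    b j = j % 4 / 2 := by
  have hc := H.nocube h0 h1 h2
  have hc3 : ∀ j, b j = b (j + 1) → b (j + 3) = b (j + 2) := by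
    intro j hj
    have hd := hc j hj
    have hh := H.hb (j + 3)
    have hh2 := H.hb (j + 2)
    rcases H.hb j with h | h
    · have := H.hl j 3 (fun u hu => by interval_cases u <;> (try simp only [Nat.add_zero]) <;> omega)
      omega
    · have := H.hc j 3 (fun u hu => by interval_cases u <;> (try simp only [Nat.add_zero]) <;> omega)
      omega
  have key : ∀ k, b (4 * k) = 0 ∧ b (4 * k + 1) = 0 := by
    intro k
    induction k with
    | zero => exact ⟨h0, h1⟩
    | succ k ih =>
      obtain ⟨e0, e1⟩ := ih
      have a1 := hc (4 * k) (by omega)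
      have a2 := hc3 (4 * k) (by omega)
      have a3 := hc (4 * k + 2) (by rw [a2])
      have a4 := hc3 (4 * k + 2) (by rw [a2])
      simp only [add_assoc, Nat.reduceAdd] at a3 a4
      rw [show 4 * (k + 1) = 4 * k + 4 by ring]
      simp only [add_assoc, Nat.reduceAdd]
      omega
  obtain ⟨e0, e1⟩ := key (j / 4)
  have a1 := hc (4 * (j / 4)) (by omega)
  have a2 := hc3 (4 * (j / 4)) (by omega)
  have : j % 4 < 4 := Nat.mod_lt _ (by norm_num)
  have hj := Nat.div_add_mod j 4
  generalize j % 4 = c at *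
  rw [← hj]
  interval_cases c <;> simp <;> omega

/-- The odd-type deviation is impossible. -/
lemma odd_dev (H : MinWord m b) (hm : m % 4 = 2) (hm6 : 6 ≤ m) (h0 : b 0 = 0) (h1 : b 1 = 0)
    (h2 : b 2 = 1) (h3 : b 3 = 0) (a : ℕ) (ha : 1 ≤ a)
    (hg : ∀ j, 4 ≤ j → j < 4 * a + 3 → b j = 1 - j % 4 / 2) (hd : b (4 * a + 3) = 1) : False := by
  have hc := H.nocube h0 h1 h2
  have h4 : b 4 = 1 := by rw [hg 4 (by omega) (by omega)]
  have h5 : b 5 = 1 := by rw [hg 5 (by omega) (by omega)]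
  have f4 : ∀ j, b j = b (j + 1) → b (j + 3) = b j → b (j + 4) = b (j + 2) := by
    intro j hj hj3
    have hd := hc j hj
    have hh := H.hb (j + 4)
    have hh2 := H.hb (j + 2)
    rcases H.hb j with h | h
    · have := H.hl j 4 (fun u hu => by interval_cases u <;> (try simp only [Nat.add_zero]) <;> omega)
      omega
    · have := H.hc j 4 (fun u hu => by interval_cases u <;> (try simp only [Nat.add_zero]) <;> omega)
      omega
  have f5 : ∀ j, b j = b (j + 1) → b (j + 3) = b j → b (j + 5) = b (j + 2) := by
    intro j hj hj3
    have hd := hc j hj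
    have hd4 := f4 j hj hj3
    have hh := H.hb (j + 5)
    have hh2 := H.hb (j + 2)
    rcases H.hb j with h | h
    · have := H.hl j 5 (fun u hu => by interval_cases u <;> (try simp only [Nat.add_zero]) <;> omega)
      omega
    · have := H.hc j 5 (fun u hu => by interval_cases u <;> (try simp only [Nat.add_zero]) <;> omega)
      omega
  -- new block
  have newblock : ∀ j, b j = b (j + 1) → b (j + 3) = b j →
      (∀ u < 6, b (j + u) = b u) ∨ (∀ u < 6, b (j + u) + b u = 1) := by
    intro j hj hj3
    have a2 := hc j hj
    have a4 := f4 j hj hj3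
    have a5 := f5 j hj hj3
    rcases H.hb j with h | h
    · left; intro u hu; interval_cases u <;> (try simp only [Nat.add_zero]) <;> omega
    · right; intro u hu; interval_cases u <;> (try simp only [Nat.add_zero]) <;> omega
  -- one step
  have step : ∀ e L, 6 ≤ L → L ≤ 4 * a + 2 → L % 4 = 2 →
      ((∀ u < L, b (e + u) = b u) ∨ (∀ u < L, b (e + u) + b u = 1)) →
      b (e + L) + b (e + L - 1) = 1 ∧ b (e + L - 2) = b (e + L - 1) ∧
      (b (e + L + 1) = b (e + L) → L + 4 ≤ 4 * a + 2 ∧ b (e + L + 2) + b (e + L + 1) = 1 ∧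
        b (e + L + 3) = b (e + L + 2) ∧
        ((∀ u < L + 4, b (e + u) = b u) ∨ (∀ u < L + 4, b (e + u) + b u = 1))) := by
    intro e L hL6 hLa hL4 hm
    have g2 : b (L - 2) = 1 := by rw [hg (L - 2) (by omega) (by omega)]; omega
    have g1 : b (L - 1) = 1 := by rw [hg (L - 1) (by omega) (by omega)]; omega
    have g0 : b L = 0 := by rw [hg L (by omega) (by omega)]; omega
    have hq : b (e + L - 2) = b (e + L - 1) := by
      rcases hm with hm | hm
      · have k1 := hm (L - 2) (by omega)
        have k2 := hm (L - 1) (by omega)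
        rw [show e + L - 2 = e + (L - 2) by omega, show e + L - 1 = e + (L - 1) by omega]; omega
      · have k1 := hm (L - 2) (by omega)
        have k2 := hm (L - 1) (by omega)
        rw [show e + L - 2 = e + (L - 2) by omega, show e + L - 1 = e + (L - 1) by omega]; omega
    have k0 := hc (e + L - 2)
    rw [show e + L - 2 + 1 = e + L - 1 by omega, show e + L - 2 + 2 = e + L by omega] at k0
    have k0' := k0 hq
    refine ⟨k0', hq, ?_⟩
    intro hs
    have hlast : b (e + L - 1) = b (e + (L - 1)) := by rw [show e + L - 1 = e + (L - 1) by omega]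
    have hL : L ≠ 4 * a + 2 := by
      rintro rfl
      rw [show e + (4 * a + 2) + 1 = e + (4 * a + 3) by ring] at hs
      rcases hm with hm | hm
      · have k2 := hm (4 * a + 2 - 1) (by omega)
        have := H.hl e (4 * a + 3) (fun u hu => by
          rcases Nat.lt_or_ge u (4 * a + 2) with h | h
          · exact hm u h
          · obtain rfl : u = 4 * a + 2 := by omega
            omega)
        omega
      · have k2 := hm (4 * a + 2 - 1) (by omega)
        have := H.hc e (4 * a + 3) (fun u hu => by
          rcases Nat.lt_or_ge u (4 * a + 2) with h | h
          · exact hm u h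
          · obtain rfl : u = 4 * a + 2 := by omega
            omega)
        omega
    have g3 : b (L + 1) = 0 := by rw [hg (L + 1) (by omega) (by omega)]; omega
    have g4 : b (L + 2) = 1 := by rw [hg (L + 2) (by omega) (by omega)]; omega
    have g5 : b (L + 3) = 1 := by rw [hg (L + 3) (by omega) (by omega)]; omega
    have k2 := hc (e + L) hs.symm
    have hv := H.hb (e + L + 3)
    refine ⟨by omega, k2, ?_⟩
    have hcase : ∀ u < L + 4, u < L ∨ u = L ∨ u = L + 1 ∨ u = L + 2 ∨ u = L + 3 := by
      intro u hu; omega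
    rcases hm with hm | hm
    · have k1 := hm (L - 1) (by omega)
      have k3 := H.hl e (L + 3) (fun u hu => by
          rcases hcase u (by omega) with h | rfl | rfl | rfl | h
          · exact hm u h
          · omega
          · rw [← add_assoc]; omega
          · rw [← add_assoc]; omega
          · omega)
      rw [← add_assoc] at k3
      refine ⟨by omega, Or.inl ?_⟩
      intro u hu
      rcases hcase u (by omega) with h | rfl | rfl | rfl | rfl
      · exact hm u h
      · omega
      · rw [← add_assoc]; omega
      · rw [← add_assoc]; omega
      · rw [← add_assoc]; omega
    · have k1 := hm (L - 1) (by omega)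
      have k3 := H.hc e (L + 3) (fun u hu => by
          rcases hcase u (by omega) with h | rfl | rfl | rfl | h
          · exact hm u h
          · omega
          · rw [← add_assoc]; omega
          · rw [← add_assoc]; omega
          · omega)
      rw [← add_assoc] at k3
      refine ⟨by omega, Or.inr ?_⟩
      intro u hu
      rcases hcase u (by omega) with h | rfl | rfl | rfl | rfl
      · exact hm u h
      · omega
      · rw [← add_assoc]; omega
      · rw [← add_assoc]; omega
      · rw [← add_assoc]; omega
  have inv : ∀ c, ∃ e L, e + L = 4 * (c + 1) + 2 ∧ 6 ≤ L ∧ L ≤ 4 * a + 2 ∧ L % 4 = 2 ∧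
      ((∀ u < L, b (e + u) = b u) ∨ (∀ u < L, b (e + u) + b u = 1)) := by
    intro c
    induction c with
    | zero => exact ⟨0, 6, by omega, by omega, by omega, by omega, Or.inl (by simp)⟩
    | succ c ih =>
      obtain ⟨e, L, hE, hL6, hLa, hL4, hm⟩ := ih
      obtain ⟨s1, s2, s3⟩ := step e L hL6 hLa hL4 hm
      by_cases hs : b (e + L + 1) = b (e + L)
      · obtain ⟨t1, t2, t3, t4⟩ := s3 hs
        exact ⟨e, L + 4, by omega, by omega, t1, by omega, t4⟩
      · have v1 := H.hb (e + L + 1)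
        have v2 := H.hb (e + L)
        have nb := newblock (e + L - 2)
        rw [show e + L - 2 + 1 = e + L - 1 by omega, show e + L - 2 + 3 = e + L + 1 by omega] at nb
        exact ⟨e + L - 2, 6, by omega, by omega, by omega, by omega, nb s2 (by omega)⟩
  obtain ⟨e, L, hE, hL6, hLa, hL4, hmm⟩ := inv (m / 4 - 1)
  obtain ⟨s1, s2, s3⟩ := step e L hL6 hLa hL4 hmm
  have hEm : e + L = m := by omega
  rw [hEm] at s1 s3
  have v0 := H.ha 0
  have v1 := H.ha 1
  have v2 := H.ha 2
  have v3 := H.ha 3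
  rw [show (0 : ℕ) + m = m by ring] at v0
  rw [show 1 + m = m + 1 by ring] at v1
  rw [show 2 + m = m + 2 by ring] at v2
  rw [show 3 + m = m + 3 by ring] at v3
  obtain ⟨t1, t2, t3, t4⟩ := s3 (by omega)
  omega
end MinWord

/-- first word -/
def w1 (j : ℕ) : ℕ := j % 4 / 2
/-- second word -/
def w2 (m j : ℕ) : ℕ :=
  if j < 2 then 0 else if j = 2 then 1 else if j + 1 = m then 0 else if j % 4 < 2 then 1 else 0
/-- third word, m at least 10 -/
def w3 (m j : ℕ) : ℕ :=
  if j < 2 then 0 else if j = 2 then 1 else if j + 5 = m then 0 else if j + 4 = m then 1 else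
  if j + 3 = m then 1 else if j + 2 = m then 0 else if j + 1 = m then 0 else
  if j % 4 < 2 then 1 else 0
/-- third word, m = 6 -/
def w3' (j : ℕ) : ℕ := if j = 3 ∨ j = 4 then 1 else 0

set_option maxHeartbeats 2000000 in
lemma comb10 {m : ℕ} {b : ℕ → ℕ} (H : MinWord m b) (hm : m % 4 = 2) (hm10 : 10 ≤ m) (t : ℕ)
    (ht : t < m) (hag : ∀ u < t, b u = w3 m u) (hlt : w3 m t < b t) :
    (∀ j < m, b j = w1 j) ∨ (∀ j < m, b j = w2 m j) := by
  obtain ⟨h0, h1⟩ := H.start (by omega)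
  -- general comparison principle
  have cmp : ∀ p < m, (∀ u < p, b u = w3 m u) → w3 m p ≤ b p := by
    intro p hp hpa
    rcases lt_trichotomy t p with h | h | h
    · have := hpa t h; omega
    · subst h; omega
    · exact (hag p h).ge
  have h2 : b 2 = 1 := by
    have := cmp 2 (by omega) (fun u hu => by interval_cases u <;> simp [w3, *])
    have := H.hb 2
    have e : w3 m 2 = 1 := by simp [w3]
    omega
  rcases H.hb 3 with h3 | h3
  swap
  · left; intro j _; exact H.case1 h0 h1 h2 h3 j
  right
  have hc := H.nocube h0 h1 h2
  have w30 : w3 m 0 = 0 := by simp [w3]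
  have w31 : w3 m 1 = 0 := by simp [w3]
  have w32 : w3 m 2 = 1 := by simp [w3]
  have w33 : w3 m 3 = 0 := by unfold w3; split_ifs <;> omega
  have w34 : w3 m 4 = 1 := by unfold w3; split_ifs <;> omega
  have h4 : b 4 = 1 := by
    have := cmp 4 (by omega) (fun u hu => by interval_cases u <;> simp [*])
    have := H.hb 4
    omega
  have v0 := H.ha 0
  have v1 := H.ha 1
  rw [show (0 : ℕ) + m = m by ring] at v0
  rw [show 1 + m = m + 1 by ring] at v1
  have hend : b (m - 1) = 0 := by
    have := hc (m - 1)
    rw [show m - 1 + 1 = m by omega, show m - 1 + 2 = m + 1 by omega] at this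
    have := H.hb (m - 1)
    omega
  -- generic up to m - 6
  have gen : ∀ p, p < m → 4 ≤ p → (∀ j, 4 ≤ j → j < p → b j = 1 - j % 4 / 2) →
      (p % 4 = 1 → p + 5 < m) → b p = 1 - p % 4 / 2 := by
    intro p hp hp4 hpre hp1
    have h40 : p % 4 = 0 ∨ p % 4 = 1 ∨ p % 4 = 2 ∨ p % 4 = 3 := by omega
    have hbp := H.hb p
    rcases h40 with h | h | h | h
    · rcases Nat.lt_or_ge p 8 with h8 | h8
      · obtain rfl : p = 4 := by omega
        simpa using h4
      · have a1 := hpre (p - 1) (by omega) (by omega)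
        have a2 := hpre (p - 2) (by omega) (by omega)
        have := hc (p - 2)
        rw [show p - 2 + 1 = p - 1 by omega, show p - 2 + 2 = p by omega] at this
        have := this (by omega)
        omega
    · have := cmp p hp (fun u hu => by
        rcases Nat.lt_or_ge u 4 with h8 | h8
        · interval_cases u <;> omega
        · rw [hpre u h8 hu]
          have := hp1 h
          unfold w3; split_ifs <;> omega)
      have e : w3 m p = 1 := by
        have := hp1 h
        unfold w3; split_ifs <;> omega
      omega
    · have a1 := hpre (p - 1) (by omega) (by omega)
      have a2 := hpre (p - 2) (by omega) (by omega)
      have := hc (p - 2)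
      rw [show p - 2 + 1 = p - 1 by omega, show p - 2 + 2 = p by omega] at this
      have := this (by omega)
      omega
    · rcases hbp with hbp | hbp
      · omega
      · exfalso
        have hpe : p = 4 * (p / 4) + 3 := by omega
        refine H.odd_dev hm (by omega) h0 h1 h2 h3 (p / 4) (by omega) ?_ ?_
        · intro j hj hjp; exact hpre j hj (by omega)
        · rw [← hpe]; exact hbp
  have G1 : ∀ j, 4 ≤ j → j + 5 < m → b j = 1 - j % 4 / 2 := by
    intro j
    induction j using Nat.strong_induction_on with
    | _ j ih =>
      intro hj hjm
      exact gen j (by omega) hj (fun i hi hij => ih i hij hi (by omega)) (fun _ => hjm)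
  rcases H.hb (m - 5) with hdev | hdev
  · -- equal to w3 up to m - 4
    exfalso
    have e5 : w3 m (m - 5) = 0 := by unfold w3; split_ifs <;> omega
    have e4 : w3 m (m - 4) = 1 := by unfold w3; split_ifs <;> omega
    have e3 : w3 m (m - 3) = 1 := by unfold w3; split_ifs <;> omega
    have e2 : w3 m (m - 2) = 0 := by unfold w3; split_ifs <;> omega
    have e1 : w3 m (m - 1) = 0 := by unfold w3; split_ifs <;> omega
    have A5 : ∀ u < m - 5, b u = w3 m u := by
      intro u hu
      rcases Nat.lt_or_ge u 4 with h8 | h8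
      · interval_cases u <;> omega
      · rw [G1 u h8 (by omega)]
        unfold w3; split_ifs <;> omega
    have A4 : ∀ u < m - 4, b u = w3 m u := by
      intro u hu
      rcases Nat.lt_or_ge u (m - 5) with h | h
      · exact A5 u h
      · obtain rfl : u = m - 5 := by omega
        omega
    have b4 := cmp (m - 4) (by omega) A4
    have c4 := H.hb (m - 4)
    have A3 : ∀ u < m - 3, b u = w3 m u := by
      intro u hu
      rcases Nat.lt_or_ge u (m - 4) with h | h
      · exact A4 u h
      · obtain rfl : u = m - 4 := by omega
        omega
    have b3 := cmp (m - 3) (by omega) A3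
    have c3 := H.hb (m - 3)
    have c2 := hc (m - 4)
    rw [show m - 4 + 1 = m - 3 by omega, show m - 4 + 2 = m - 2 by omega] at c2
    have c2' := c2 (by omega)
    have : b t = w3 m t := by
      rcases Nat.lt_or_ge t (m - 3) with h | h
      · exact A3 t h
      · have : t = m - 3 ∨ t = m - 2 ∨ t = m - 1 := by omega
        rcases this with rfl | rfl | rfl <;> omega
    omega
  · have G2 : ∀ j, 4 ≤ j → j + 1 < m → b j = 1 - j % 4 / 2 := by
      intro j
      induction j using Nat.strong_induction_on with
      | _ j ih =>
        intro hj hjm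
        by_cases hj5 : j = m - 5
        · subst hj5; omega
        · exact gen j (by omega) hj (fun i hi hij => ih i hij hi (by omega)) (fun _ => by omega)
    intro j hj
    rcases Nat.lt_or_ge j 4 with h8 | h8
    · unfold w2
      interval_cases j <;> split_ifs <;> omega
    · by_cases hj1 : j = m - 1
      · subst hj1
        rw [hend]; unfold w2; split_ifs <;> omega
      · rw [G2 j h8 (by omega)]
        unfold w2; split_ifs <;> omega

lemma comb6 {b : ℕ → ℕ} (H : MinWord 6 b) (t : ℕ)
    (ht : t < 6) (hag : ∀ u < t, b u = w3' u) (hlt : w3' t < b t) :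
    (∀ j < 6, b j = w1 j) ∨ (∀ j < 6, b j = w2 6 j) := by
  obtain ⟨h0, h1⟩ := H.start (by omega)
  have v0 := H.ha 0
  have v1 := H.ha 1
  have v2 := H.ha 2
  have v3 := H.ha 3
  have v4 := H.ha 4
  have v5 := H.ha 5
  have v6 := H.ha 6
  simp only [Nat.reduceAdd] at v0 v1 v2 v3 v4 v5 v6
  have c3 := H.hb 3
  have c4 := H.hb 4
  have c5 := H.hb 5
  rcases H.hb 2 with h2 | h2
  · exfalso
    have hall : b 3 = 1 ∧ b 4 = 1 ∧ b 5 = 1 := by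
      have g0 := hag 0
      have g1 := hag 1
      have g2 := hag 2
      have g3 := hag 3
      have g4 := hag 4
      have g5 := hag 5
      simp [w3'] at g0 g1 g2 g3 g4 g5
      interval_cases t <;> simp [w3'] at * <;> omega
    have := H.hl 9 3 (fun u hu => by
      interval_cases u <;> simp only [Nat.reduceAdd] <;> omega)
    simp only [Nat.reduceAdd] at this
    omega
  have hc := H.nocube h0 h1 h2
  rcases c3 with h3 | h3
  swap
  · left; intro j _; exact H.case1 h0 h1 h2 h3 j
  right
  have k3 := hc 3
  have k5 := hc 5
  simp only [Nat.reduceAdd] at k3 k5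
  have h5 : b 5 = 0 := by omega
  have h4 : b 4 = 1 := by omega
  intro j hj
  interval_cases j <;> simp [w2, *]

/-- antiperiodic extension -/
def ext (m : ℕ) (w : ℕ → ℕ) (j : ℕ) : ℕ := if j / m % 2 = 0 then w (j % m) else 1 - w (j % m)

/-- antiperiodic binary word -/
structure Anti (m : ℕ) (e : ℕ → ℕ) : Prop where
  hb : ∀ j, e j = 0 ∨ e j = 1
  ha : ∀ j, e (j + m) + e j = 1

lemma ext_low {m j : ℕ} (w : ℕ → ℕ) (h : j < m) : ext m w j = w j := by
  simp [ext, Nat.div_eq_of_lt h, Nat.mod_eq_of_lt h]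

lemma ext_anti {m : ℕ} (hm : 0 < m) (w : ℕ → ℕ) (hw : ∀ j, w j = 0 ∨ w j = 1) :
    Anti m (ext m w) := by
  constructor
  · intro j
    have := hw (j % m)
    unfold ext; split_ifs <;> omega
  · intro j
    have := hw (j % m)
    unfold ext
    rw [Nat.add_div_right _ hm, Nat.add_mod_right]
    split_ifs <;> omega

/-- strictly minimal -/
def StrictMin (m : ℕ) (e : ℕ → ℕ) : Prop :=
  ∀ i, 0 < i → i < 2 * m → ∃ t, (∀ u < t, e (i + u) = e u) ∧ e t < e (i + t)

lemma strictMin_of {m : ℕ} {e : ℕ → ℕ} (H : Anti m e)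
    (h1 : ∀ i, 0 < i → i < m → ∃ t, (∀ u < t, e (i + u) = e u) ∧ e t < e (i + t))
    (h2 : ∀ i, i < m → ∃ t, (∀ u < t, e (i + u) + e u = 1) ∧ e t + e (i + t) < 1) :
    StrictMin m e := by
  intro i hi him
  rcases Nat.lt_or_ge i m with h | h
  · exact h1 i hi h
  · obtain ⟨t, ht, ht2⟩ := h2 (i - m) (by omega)
    refine ⟨t, fun u hu => ?_, ?_⟩
    · have a := ht u hu
      have b := H.ha (i - m + u)
      rw [show i - m + u + m = i + u by omega] at b
      omega
    · have b := H.ha (i - m + t)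
      rw [show i - m + t + m = i + t by omega] at b
      omega

lemma anti_w1 {m : ℕ} (hm : m % 4 = 2) : Anti m w1 := by
  constructor
  · intro j; unfold w1; omega
  · intro j; unfold w1; omega

lemma anti_w2 {m : ℕ} (hm : 0 < m) : Anti m (ext m (w2 m)) :=
  ext_anti hm _ (fun j => by unfold w2; split_ifs <;> simp)

lemma anti_w3 {m : ℕ} (hm : 0 < m) : Anti m (ext m (w3 m)) :=
  ext_anti hm _ (fun j => by unfold w3; split_ifs <;> simp)

lemma anti_w3' : Anti 6 (ext 6 w3') :=
  ext_anti (by norm_num) _ (fun j => by unfold w3'; split_ifs <;> simp)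

lemma strict_w26 : StrictMin 6 (ext 6 (w2 6)) := by
  have : ∀ i < 12, 0 < i → ∃ t < 6, (∀ u < t, ext 6 (w2 6) (i + u) = ext 6 (w2 6) u) ∧
      ext 6 (w2 6) t < ext 6 (w2 6) (i + t) := by decide
  intro i h0 hi
  obtain ⟨t, _, h⟩ := this i (by omega) h0
  exact ⟨t, h⟩

lemma strict_w36 : StrictMin 6 (ext 6 w3') := by
  have : ∀ i < 12, 0 < i → ∃ t < 6, (∀ u < t, ext 6 w3' (i + u) = ext 6 w3' u) ∧
      ext 6 w3' t < ext 6 w3' (i + t) := by decide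
  intro i h0 hi
  obtain ⟨t, _, h⟩ := this i (by omega) h0
  exact ⟨t, h⟩

lemma strict_w2 {m : ℕ} (hm : m % 4 = 2) (hm10 : 10 ≤ m) : StrictMin m (ext m (w2 m)) := by
  have H := anti_w2 (m := m) (by omega)
  have hl : ∀ j < m, ext m (w2 m) j = w2 m j := fun j hj => ext_low _ hj
  generalize ext m (w2 m) = e at *
  have e0 : e 0 = 0 := by rw [hl 0 (by omega)]; simp [w2]
  have e1 : e 1 = 0 := by rw [hl 1 (by omega)]; simp [w2]
  have e2 : e 2 = 1 := by rw [hl 2 (by omega)]; simp [w2]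
  have g : ∀ j, 3 ≤ j → j + 1 < m → e j = 1 - j % 4 / 2 := by
    intro j h1 h2
    rw [hl j (by omega)]; unfold w2; split_ifs <;> omega
  have el : e (m - 1) = 0 := by
    rw [hl (m - 1) (by omega)]; unfold w2; split_ifs <;> omega
  clear hl
  have e3 : e 3 = 0 := by rw [g 3 (by omega) (by omega)]
  have e4 : e 4 = 1 := by rw [g 4 (by omega) (by omega)]
  have e5 : e 5 = 1 := by rw [g 5 (by omega) (by omega)]
  have e6 : e 6 = 0 := by rw [g 6 (by omega) (by omega)]
  have e7 : e 7 = 0 := by rw [g 7 (by omega) (by omega)]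
  have v0 := H.ha 0
  have v1 := H.ha 1
  have v2 := H.ha 2
  have v3 := H.ha 3
  rw [show (0 : ℕ) + m = m by ring] at v0
  rw [show 1 + m = m + 1 by ring] at v1
  rw [show 2 + m = m + 2 by ring] at v2
  rw [show 3 + m = m + 3 by ring] at v3
  apply strictMin_of H
  · intro i hi him
    rcases Nat.lt_or_ge i 4 with h4 | h4
    · interval_cases i
      · exact ⟨1, fun u hu => by interval_cases u; simp only [Nat.add_zero]; omega, by simp only [Nat.reduceAdd]; omega⟩
      · exact ⟨0, by simp, by simp only [Nat.add_zero]; omega⟩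
      · exact ⟨1, fun u hu => by interval_cases u; simp only [Nat.add_zero]; omega, by simp only [Nat.reduceAdd]; omega⟩
    by_cases hi1 : i = m - 1
    · subst hi1
      refine ⟨1, fun u hu => by interval_cases u; simp only [Nat.add_zero]; omega, ?_⟩
      rw [show m - 1 + 1 = m by omega]; omega
    by_cases hi4 : i = m - 4
    · subst hi4
      have a0 := g (m - 4) (by omega) (by omega)
      have a1 := g (m - 3) (by omega) (by omega)
      have a2 := g (m - 2) (by omega) (by omega)
      refine ⟨7, fun u hu => ?_, ?_⟩
      · interval_cases u
        · simp only [Nat.add_zero]; omega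
        · rw [show m - 4 + 1 = m - 3 by omega]; omega
        · rw [show m - 4 + 2 = m - 2 by omega]; omega
        · rw [show m - 4 + 3 = m - 1 by omega]; omega
        · rw [show m - 4 + 4 = m by omega]; omega
        · rw [show m - 4 + 5 = m + 1 by omega]; omega
        · rw [show m - 4 + 6 = m + 2 by omega]; omega
      · rw [show m - 4 + 7 = m + 3 by omega]; omega
    have a0 := g i (by omega) (by omega)
    have h40 : i % 4 = 0 ∨ i % 4 = 1 ∨ i % 4 = 2 ∨ i % 4 = 3 := by omega
    rcases h40 with h | h | h | h
    · exact ⟨0, by simp, by simp only [Nat.add_zero]; omega⟩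
    · exact ⟨0, by simp, by simp only [Nat.add_zero]; omega⟩
    · have a1 := g (i + 1) (by omega) (by omega)
      have a2 := g (i + 2) (by omega) (by omega)
      have a3 := g (i + 3) (by omega) (by omega)
      exact ⟨3, fun u hu => by interval_cases u <;> (try simp only [Nat.add_zero]) <;> omega, by omega⟩
    · have a1 := g (i + 1) (by omega) (by omega)
      exact ⟨1, fun u hu => by interval_cases u; simp only [Nat.add_zero]; omega, by omega⟩
  · intro i him
    rcases Nat.lt_or_ge i 4 with h4 | h4
    · interval_cases i
      · exact ⟨0, by simp, by simp only [Nat.add_zero]; omega⟩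
      · exact ⟨0, by simp, by simp only [Nat.add_zero]; omega⟩
      · exact ⟨1, fun u hu => by interval_cases u; simp only [Nat.add_zero]; omega, by simp only [Nat.reduceAdd]; omega⟩
      · exact ⟨0, by simp, by simp only [Nat.add_zero]; omega⟩
    by_cases hi1 : i = m - 1
    · subst hi1
      exact ⟨0, by simp, by simp only [Nat.add_zero]; omega⟩
    have a0 := g i (by omega) (by omega)
    by_cases hi2 : i = m - 2
    · subst hi2
      refine ⟨1, fun u hu => by interval_cases u; simp only [Nat.add_zero]; omega, ?_⟩
      rw [show m - 2 + 1 = m - 1 by omega]; omega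
    have h40 : i % 4 = 0 ∨ i % 4 = 1 ∨ i % 4 = 2 ∨ i % 4 = 3 := by omega
    rcases h40 with h | h | h | h
    · have a1 := g (i + 1) (by omega) (by omega)
      have a2 := g (i + 2) (by omega) (by omega)
      have a3 := g (i + 3) (by omega) (by omega)
      exact ⟨3, fun u hu => by interval_cases u <;> (try simp only [Nat.add_zero]) <;> omega, by omega⟩
    · have a1 := g (i + 1) (by omega) (by omega)
      exact ⟨1, fun u hu => by interval_cases u; simp only [Nat.add_zero]; omega, by omega⟩
    · exact ⟨0, by simp, by simp only [Nat.add_zero]; omega⟩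
    · exact ⟨0, by simp, by simp only [Nat.add_zero]; omega⟩

set_option maxHeartbeats 2000000 in
lemma strict_w3 {m : ℕ} (hm : m % 4 = 2) (hm10 : 10 ≤ m) : StrictMin m (ext m (w3 m)) := by
  have H := anti_w3 (m := m) (by omega)
  have hl : ∀ j < m, ext m (w3 m) j = w3 m j := fun j hj => ext_low _ hj
  generalize ext m (w3 m) = e at *
  have e0 : e 0 = 0 := by rw [hl 0 (by omega)]; simp [w3]
  have e1 : e 1 = 0 := by rw [hl 1 (by omega)]; simp [w3]
  have e2 : e 2 = 1 := by rw [hl 2 (by omega)]; simp [w3]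
  have g : ∀ j, 3 ≤ j → j + 5 < m → e j = 1 - j % 4 / 2 := by
    intro j h1 h2
    rw [hl j (by omega)]; unfold w3; split_ifs <;> omega
  have l5 : e (m - 5) = 0 := by rw [hl _ (by omega)]; unfold w3; split_ifs <;> omega
  have l4 : e (m - 4) = 1 := by rw [hl _ (by omega)]; unfold w3; split_ifs <;> omega
  have l3 : e (m - 3) = 1 := by rw [hl _ (by omega)]; unfold w3; split_ifs <;> omega
  have l2 : e (m - 2) = 0 := by rw [hl _ (by omega)]; unfold w3; split_ifs <;> omega
  have l1 : e (m - 1) = 0 := by rw [hl _ (by omega)]; unfold w3; split_ifs <;> omega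
  clear hl
  have e3 : e 3 = 0 := by rw [g 3 (by omega) (by omega)]
  have e4 : e 4 = 1 := by rw [g 4 (by omega) (by omega)]
  have v0 := H.ha 0
  have v1 := H.ha 1
  have v2 := H.ha 2
  have v3 := H.ha 3
  rw [show (0 : ℕ) + m = m by ring] at v0
  rw [show 1 + m = m + 1 by ring] at v1
  rw [show 2 + m = m + 2 by ring] at v2
  rw [show 3 + m = m + 3 by ring] at v3
  apply strictMin_of H
  · intro i hi him
    rcases Nat.lt_or_ge i 4 with h4 | h4
    · interval_cases i
      · exact ⟨1, fun u hu => by interval_cases u; simp only [Nat.add_zero]; omega, by simp only [Nat.reduceAdd]; omega⟩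
      · exact ⟨0, by simp, by simp only [Nat.add_zero]; omega⟩
      · exact ⟨1, fun u hu => by interval_cases u; simp only [Nat.add_zero]; omega, by simp only [Nat.reduceAdd]; omega⟩
    by_cases hi1 : i = m - 1
    · subst hi1
      refine ⟨1, fun u hu => by interval_cases u; simp only [Nat.add_zero]; omega, ?_⟩
      rw [show m - 1 + 1 = m by omega]; omega
    by_cases hi2 : i = m - 2
    · subst hi2
      refine ⟨3, fun u hu => ?_, ?_⟩
      · interval_cases u
        · simp only [Nat.add_zero]; omega
        · rw [show m - 2 + 1 = m - 1 by omega]; omega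
        · rw [show m - 2 + 2 = m by omega]; omega
      · rw [show m - 2 + 3 = m + 1 by omega]; omega
    by_cases hi3 : i = m - 3
    · subst hi3
      exact ⟨0, by simp, by simp only [Nat.add_zero]; omega⟩
    by_cases hi4 : i = m - 4
    · subst hi4
      exact ⟨0, by simp, by simp only [Nat.add_zero]; omega⟩
    by_cases hi5 : i = m - 5
    · subst hi5
      refine ⟨1, fun u hu => by interval_cases u; simp only [Nat.add_zero]; omega, ?_⟩
      rw [show m - 5 + 1 = m - 4 by omega]; omega
    by_cases hi8 : i = m - 8
    · subst hi8
      have e5 : e 5 = 1 := by rw [g 5 (by omega) (by omega)]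
      have e6 : e 6 = 0 := by rw [g 6 (by omega) (by omega)]
      have e7 : e 7 = 0 := by rw [g 7 (by omega) (by omega)]
      have e8 : e 8 = 1 := by rw [g 8 (by omega) (by omega)]
      have a8 := g (m - 8) (by omega) (by omega)
      have a7 := g (m - 7) (by omega) (by omega)
      have a6 := g (m - 6) (by omega) (by omega)
      have b0 : e (m - 8 + 0) = 0 := by simp only [Nat.add_zero]; omega
      have b1 : e (m - 8 + 1) = 0 := by rw [show m - 8 + 1 = m - 7 by omega]; omega
      have b2 : e (m - 8 + 2) = 1 := by rw [show m - 8 + 2 = m - 6 by omega]; omega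
      have b3 : e (m - 8 + 3) = 0 := by rw [show m - 8 + 3 = m - 5 by omega]; omega
      have b4 : e (m - 8 + 4) = 1 := by rw [show m - 8 + 4 = m - 4 by omega]; omega
      have b5 : e (m - 8 + 5) = 1 := by rw [show m - 8 + 5 = m - 3 by omega]; omega
      have b6 : e (m - 8 + 6) = 0 := by rw [show m - 8 + 6 = m - 2 by omega]; omega
      have b7 : e (m - 8 + 7) = 0 := by rw [show m - 8 + 7 = m - 1 by omega]; omega
      have b8 : e (m - 8 + 8) = 1 := by rw [show m - 8 + 8 = m by omega]; omega
      have b9 : e (m - 8 + 9) = 1 := by rw [show m - 8 + 9 = m + 1 by omega]; omega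
      have b10 : e (m - 8 + 10) = 0 := by rw [show m - 8 + 10 = m + 2 by omega]; omega
      have b11 : e (m - 8 + 11) = 1 := by rw [show m - 8 + 11 = m + 3 by omega]; omega
      by_cases h14 : m = 14
      · have e9 : e 9 = 0 := by rw [show 9 = m - 5 by omega]; exact l5
        exact ⟨9, fun u hu => by interval_cases u <;> omega, by omega⟩
      · have e9 : e 9 = 1 := by rw [g 9 (by omega) (by omega)]
        have e10 : e 10 = 0 := by rw [g 10 (by omega) (by omega)]
        have e11 : e 11 = 0 := by rw [g 11 (by omega) (by omega)]
        exact ⟨11, fun u hu => by interval_cases u <;> omega, by omega⟩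
    have a0 := g i (by omega) (by omega)
    have h40 : i % 4 = 0 ∨ i % 4 = 1 ∨ i % 4 = 2 ∨ i % 4 = 3 := by omega
    rcases h40 with h | h | h | h
    · exact ⟨0, by simp, by simp only [Nat.add_zero]; omega⟩
    · exact ⟨0, by simp, by simp only [Nat.add_zero]; omega⟩
    · have a1 := g (i + 1) (by omega) (by omega)
      have a2 := g (i + 2) (by omega) (by omega)
      have a3 := g (i + 3) (by omega) (by omega)
      exact ⟨3, fun u hu => by interval_cases u <;> (try simp only [Nat.add_zero]) <;> omega, by omega⟩
    · have a1 := g (i + 1) (by omega) (by omega)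
      exact ⟨1, fun u hu => by interval_cases u; simp only [Nat.add_zero]; omega, by omega⟩
  · intro i him
    rcases Nat.lt_or_ge i 4 with h4 | h4
    · interval_cases i
      · exact ⟨0, by simp, by simp only [Nat.add_zero]; omega⟩
      · exact ⟨0, by simp, by simp only [Nat.add_zero]; omega⟩
      · exact ⟨1, fun u hu => by interval_cases u; simp only [Nat.add_zero]; omega, by simp only [Nat.reduceAdd]; omega⟩
      · exact ⟨0, by simp, by simp only [Nat.add_zero]; omega⟩
    by_cases hi1 : i = m - 1
    · subst hi1
      exact ⟨0, by simp, by simp only [Nat.add_zero]; omega⟩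
    by_cases hi2 : i = m - 2
    · subst hi2
      exact ⟨0, by simp, by simp only [Nat.add_zero]; omega⟩
    by_cases hi3 : i = m - 3
    · subst hi3
      refine ⟨1, fun u hu => by interval_cases u; simp only [Nat.add_zero]; omega, ?_⟩
      rw [show m - 3 + 1 = m - 2 by omega]; omega
    by_cases hi4 : i = m - 4
    · subst hi4
      refine ⟨3, fun u hu => ?_, ?_⟩
      · interval_cases u
        · simp only [Nat.add_zero]; omega
        · rw [show m - 4 + 1 = m - 3 by omega]; omega
        · rw [show m - 4 + 2 = m - 2 by omega]; omega
      · rw [show m - 4 + 3 = m - 1 by omega]; omega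
    by_cases hi5 : i = m - 5
    · subst hi5
      exact ⟨0, by simp, by simp only [Nat.add_zero]; omega⟩
    have a0 := g i (by omega) (by omega)
    by_cases hi6 : i = m - 6
    · subst hi6
      refine ⟨1, fun u hu => by interval_cases u; simp only [Nat.add_zero]; omega, ?_⟩
      rw [show m - 6 + 1 = m - 5 by omega]; omega
    have h40 : i % 4 = 0 ∨ i % 4 = 1 ∨ i % 4 = 2 ∨ i % 4 = 3 := by omega
    rcases h40 with h | h | h | h
    · have a1 := g (i + 1) (by omega) (by omega)
      have a2 := g (i + 2) (by omega) (by omega)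
      have a3 := g (i + 3) (by omega) (by omega)
      exact ⟨3, fun u hu => by interval_cases u <;> (try simp only [Nat.add_zero]) <;> omega, by omega⟩
    · have a1 := g (i + 1) (by omega) (by omega)
      exact ⟨1, fun u hu => by interval_cases u; simp only [Nat.add_zero]; omega, by omega⟩
    · exact ⟨0, by simp, by simp only [Nat.add_zero]; omega⟩
    · exact ⟨0, by simp, by simp only [Nat.add_zero]; omega⟩

/-- The seed with binary word `e`. -/
def seed (g m : ℕ) (e : ℕ → ℕ) : ℕ := 1 + AA (2 * (g + 1)) (fun j => g + e j) m 0

section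
variable {g m n : ℕ}

lemma seed_pos (e : ℕ → ℕ) : 0 < seed g m e := by unfold seed; omega

lemma seed_digit (hn : n = (2 * (g + 1)) ^ m + 1) {e : ℕ → ℕ} (H : Anti m e) (j : ℕ) :
    dd (2 * (g + 1)) n (seed g m e) j = g + e j :=
  word_seed hn (fun j => g + e j) (fun j => by have := H.ha j; omega) j

lemma seed_lt (hn : n = (2 * (g + 1)) ^ m + 1) {e : ℕ → ℕ} (H : Anti m e) : seed g m e < n := by
  have := AA_lt (q := 2 * (g + 1)) (fun j => g + e j) (fun j => by have := H.hb j; omega) m 0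
  unfold seed; omega

lemma seed_strict (hn : n = (2 * (g + 1)) ^ m + 1) {e : ℕ → ℕ} (H : Anti m e)
    (hs : StrictMin m e) (j : ℕ) (h0 : 0 < j) (hj : j < 2 * m) :
    seed g m e < rr (2 * (g + 1)) n (seed g m e) j := by
  obtain ⟨t, h1, h2⟩ := hs j h0 hj
  have := lex_lt (q := 2 * (g + 1)) (n := n) (by omega) t (seed g m e) (seed g m e) 0 j
    (fun u hu => by
      rw [seed_digit hn H, seed_digit hn H, h1 u hu, Nat.zero_add])
    (by rw [seed_digit hn H, seed_digit hn H, Nat.zero_add]; omega)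
  rwa [rr_zero (seed_lt hn H)] at this

lemma strict_leader (hn : n = (2 * (g + 1)) ^ m + 1) (hm : 0 < m) {e : ℕ → ℕ} (H : Anti m e)
    (hs : StrictMin m e) : seed g m e ∈ cosetLeaders (2 * (g + 1)) n := by
  rw [mem_leaders (by omega) hm hn (seed_pos e) (seed_lt hn H)]
  intro j
  have hper : ∀ k j, rr (2 * (g + 1)) n (seed g m e) (j + 2 * m * k) = rr (2 * (g + 1)) n (seed g m e) j := by
    intro k
    induction k with
    | zero => intro j; simp
    | succ k ih =>
      intro j
      rw [show j + 2 * m * (k + 1) = j + 2 * m * k + 2 * m by ring,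
        rr_period hn hm (seed_pos e) (seed_lt hn H), ih]
  have h1 := hper (j / (2 * m)) (j % (2 * m))
  rw [Nat.mod_add_div] at h1
  rw [h1]
  rcases Nat.eq_zero_or_pos (j % (2 * m)) with h | h
  · rw [h, rr_zero (seed_lt hn H)]
  · exact (seed_strict hn H hs _ h (Nat.mod_lt _ (by omega))).le

lemma w1_leader (hn : n = (2 * (g + 1)) ^ m + 1) (hm : m % 4 = 2) :
    seed g m w1 ∈ cosetLeaders (2 * (g + 1)) n := by
  have H := anti_w1 hm
  rw [mem_leaders (by omega) (by omega) hn (seed_pos w1) (seed_lt hn H)]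
  intro j
  by_cases hj : j % 4 = 0
  · have := rr_eq hn (by omega) (seed_pos w1) (seed_lt hn H) (seed_pos w1) (seed_lt hn H) 0 j
      (fun u hu => by
        rw [seed_digit hn H, seed_digit hn H]; unfold w1; omega)
    rw [rr_zero (seed_lt hn H)] at this
    exact this.le
  · have : ∃ t, (∀ u < t, w1 (j + u) = w1 u) ∧ w1 t < w1 (j + t) := by
      by_cases h1 : j % 4 = 1
      · exact ⟨1, fun u hu => by unfold w1; omega, by unfold w1; omega⟩
      · exact ⟨0, by simp, by unfold w1; omega⟩
    obtain ⟨t, h1, h2⟩ := this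
    have := lex_lt (q := 2 * (g + 1)) (n := n) (by omega) t (seed g m w1) (seed g m w1) 0 j
      (fun u hu => by
        rw [seed_digit hn H, seed_digit hn H, h1 u hu, Nat.zero_add])
      (by rw [seed_digit hn H, seed_digit hn H, Nat.zero_add]; omega)
    rw [rr_zero (seed_lt hn H)] at this
    exact this.le

lemma seed_lex (hn : n = (2 * (g + 1)) ^ m + 1) {e e' : ℕ → ℕ} (H : Anti m e) (H' : Anti m e')
    (h : ∃ t, (∀ u < t, e u = e' u) ∧ e t < e' t) : seed g m e < seed g m e' := by
  obtain ⟨t, h1, h2⟩ := h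
  have := lex_lt (q := 2 * (g + 1)) (n := n) (by omega) t (seed g m e) (seed g m e') 0 0
    (fun u hu => by
      rw [seed_digit hn H, seed_digit hn H', Nat.zero_add, h1 u hu])
    (by rw [seed_digit hn H, seed_digit hn H', Nat.zero_add]; omega)
  rwa [rr_zero (seed_lt hn H), rr_zero (seed_lt hn H')] at this

lemma classify (hn : n = (2 * (g + 1)) ^ m + 1) (hm : 0 < m) {e1 e2 e3 : ℕ → ℕ}
    (H1 : Anti m e1) (H2 : Anti m e2) (H3 : Anti m e3)
    (hcomb : ∀ b, MinWord m b → ∀ t < m, (∀ u < t, b u = e3 u) → e3 t < b t →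
      (∀ j < m, b j = e1 j) ∨ (∀ j < m, b j = e2 j))
    (x : ℕ) (hx : x ∈ cosetLeaders (2 * (g + 1)) n) (hx3 : seed g m e3 < x) :
    x = seed g m e1 ∨ x = seed g m e2 := by
  have hxn : x < n := by
    rw [cosetLeaders, Finset.mem_filter] at hx
    exact Finset.mem_range.1 hx.1
  have hx0 : 0 < x := by omega
  have hn0 : 0 < n := by omega
  rw [mem_leaders (by omega) hm hn hx0 hxn] at hx
  have hlow : ∀ j, g ≤ dd (2 * (g + 1)) n x j := by
    intro j
    have h1 := seed_digit (g := g) hn H3 0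
    have h2 : dd (2 * (g + 1)) n (seed g m e3) 0 ≤ dd (2 * (g + 1)) n x j := by
      unfold dd
      apply Nat.div_le_div_right
      apply Nat.mul_le_mul_left
      rw [rr_zero (seed_lt hn H3)]
      exact hx3.le.trans (hx j)
    omega
  have hant := dd_anti hn hm hx0 hxn
  obtain ⟨b, hb⟩ : ∃ b : ℕ → ℕ, ∀ j, dd (2 * (g + 1)) n x j = g + b j :=
    ⟨fun j => dd (2 * (g + 1)) n x j - g, fun j => by have := hlow j; simp only; omega⟩
  have hba : ∀ j, b (j + m) + b j = 1 := by
    intro j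
    have h1 := hant j
    rw [hb, hb] at h1
    omega
  have HB : MinWord m b := by
    refine ⟨fun j => by have := hba j; omega, hba, ?_⟩
    intro i t hit
    by_contra hlt
    have := lex_lt (q := 2 * (g + 1)) hn0 t x x i 0
      (fun u hu => by rw [hb, hb, hit u hu, Nat.zero_add])
      (by rw [hb, hb, Nat.zero_add]; omega)
    rw [rr_zero hxn] at this
    have := hx i
    omega
  have hne : ∃ t, t < m ∧ b t ≠ e3 t := by
    by_contra hcon
    push Not at hcon
    have := rr_eq hn hm hx0 hxn (seed_pos e3) (seed_lt hn H3) 0 0 (fun u hu => by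
      rw [hb, seed_digit hn H3, Nat.zero_add, hcon u hu])
    rw [rr_zero hxn, rr_zero (seed_lt hn H3)] at this
    omega
  classical
  obtain ⟨ht, htne⟩ := Nat.find_spec hne
  have hmin : ∀ u < Nat.find hne, b u = e3 u := by
    intro u hu
    have := Nat.find_min hne hu
    by_contra hh
    exact this ⟨by omega, hh⟩
  have hlt : e3 (Nat.find hne) < b (Nat.find hne) := by
    by_contra hh
    have := lex_lt (q := 2 * (g + 1)) hn0 (Nat.find hne) x (seed g m e3) 0 0
      (fun u hu => by rw [hb, seed_digit hn H3, Nat.zero_add, hmin u hu])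
      (by rw [hb, seed_digit hn H3, Nat.zero_add]; omega)
    rw [rr_zero hxn, rr_zero (seed_lt hn H3)] at this
    omega
  rcases hcomb b HB _ ht hmin hlt with h | h
  · left
    have := rr_eq hn hm hx0 hxn (seed_pos e1) (seed_lt hn H1) 0 0 (fun u hu => by
      rw [hb, seed_digit hn H1, Nat.zero_add, h u hu])
    rwa [rr_zero hxn, rr_zero (seed_lt hn H1)] at this
  · right
    have := rr_eq hn hm hx0 hxn (seed_pos e2) (seed_lt hn H2) 0 0 (fun u hu => by
      rw [hb, seed_digit hn H2, Nat.zero_add, h u hu])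
    rwa [rr_zero hxn, rr_zero (seed_lt hn H2)] at this

lemma assemble (hn : n = (2 * (g + 1)) ^ m + 1) (hm : m % 4 = 2) {e2 e3 : ℕ → ℕ}
    (H2 : Anti m e2) (H3 : Anti m e3) (S2 : StrictMin m e2) (S3 : StrictMin m e3)
    (h32 : ∃ t, (∀ u < t, e3 u = e2 u) ∧ e3 t < e2 t)
    (h21 : ∃ t, (∀ u < t, e2 u = w1 u) ∧ e2 t < w1 t)
    (hcomb : ∀ b, MinWord m b → ∀ t < m, (∀ u < t, b u = e3 u) → e3 t < b t →
      (∀ j < m, b j = w1 j) ∨ (∀ j < m, b j = e2 j)) :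
    nthLargestCosetLeader (2 * (g + 1)) n 2 = seed g m e2 ∧
    nthLargestCosetLeader (2 * (g + 1)) n 3 = seed g m e3 ∧
    (cycCoset (2 * (g + 1)) n (seed g m e2)).card = 2 * m ∧
    (cycCoset (2 * (g + 1)) n (seed g m e3)).card = 2 * m := by
  have hm0 : 0 < m := by omega
  have H1 := anti_w1 hm
  obtain ⟨L, hL⟩ := sort_top3 (cosetLeaders (2 * (g + 1)) n) (seed g m w1) (seed g m e2)
    (seed g m e3) (w1_leader hn hm) (strict_leader hn hm0 H2 S2) (strict_leader hn hm0 H3 S3)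
    (seed_lex hn H2 H1 h21) (seed_lex hn H3 H2 h32)
    (fun x hx hx3 => classify hn hm0 H1 H2 H3 hcomb x hx hx3)
  refine ⟨?_, ?_, ?_, ?_⟩
  · unfold nthLargestCosetLeader; rw [hL]; rfl
  · unfold nthLargestCosetLeader; rw [hL]; rfl
  · exact card_coset (by omega) hm0 hn (seed_pos _) (seed_lt hn H2) (seed_strict hn H2 S2)
  · exact card_coset (by omega) hm0 hn (seed_pos _) (seed_lt hn H3) (seed_strict hn H3 S3)

end

lemma AA_congr (q : ℕ) (D D' : ℕ → ℕ) (l : ℕ) (h : ∀ j < l, D j = D' j) :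
    AA q D l 0 = AA q D' l 0 := by
  induction l with
  | zero => rfl
  | succ l ih =>
    rw [AA, AA, ih (fun j hj => h j (by omega)), Nat.zero_add, h l (by omega)]

lemma seed2_closed (g k : ℕ) (q : ℤ) (hq : q = 2 * (g + 1)) :
    2 * (q ^ 2 + 1) * (seed g (4 * k + 6) (ext (4 * k + 6) (w2 (4 * k + 6))) : ℤ)
      = q * (q - 1) * (q ^ (4 * k + 6) - 2 * q ^ (4 * k + 2) - 1) := by
  set m := 4 * k + 6 with hm
  have hl : ∀ j < m, ext m (w2 m) j = w2 m j := fun j hj => ext_low _ hj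
  generalize ext m (w2 m) = e at *
  have e0 : e 0 = 0 := by rw [hl 0 (by omega)]; simp [w2]
  have e1 : e 1 = 0 := by rw [hl 1 (by omega)]; simp [w2]
  have e2 : e 2 = 1 := by rw [hl 2 (by omega)]; simp [w2]
  have gg : ∀ j, 3 ≤ j → j + 1 < m → e j = 1 - j % 4 / 2 := by
    intro j h1 h2
    rw [hl j (by omega)]; unfold w2; split_ifs <;> omega
  have el : e (4 * k + 5) = 0 := by
    rw [hl _ (by omega)]; unfold w2; split_ifs <;> omega
  have e3 : e 3 = 0 := by rw [gg 3 (by omega) (by omega)]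
  have key : ∀ i, i ≤ k → 2 * (q ^ 2 + 1) * (AA (2 * (g + 1)) (fun j => g + e j) (4 * i + 4) 0 : ℤ)
      + (q ^ 2 + q + 2) = q ^ (4 * i) *
        ((q ^ 2 + 1) * ((q - 2) * (q ^ 3 + q ^ 2 + q + 1) + 2 * q) + q ^ 2 + q + 2) := by
    intro i
    induction i with
    | zero =>
      intro _
      simp [AA, e0, e1, e2, e3]
      rw [hq]; ring
    | succ i ih =>
      intro hi
      have ih := ih (by omega)
      have f0 : e (4 * i + 4) = 1 := by rw [gg _ (by omega) (by omega)]; omega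
      have f1 : e (4 * i + 5) = 1 := by rw [gg _ (by omega) (by omega)]; omega
      have f2 : e (4 * i + 6) = 0 := by rw [gg _ (by omega) (by omega)]; omega
      have f3 : e (4 * i + 7) = 0 := by rw [gg _ (by omega) (by omega)]; omega
      rw [show 4 * (i + 1) + 4 = 4 * i + 4 + 1 + 1 + 1 + 1 by ring, AA, AA, AA, AA]
      simp only [Nat.zero_add, add_assoc, Nat.reduceAdd, f0, f1, f2, f3]
      push_cast
      rw [show 4 * (i + 1) = 4 * i + 4 by ring, pow_add]
      have hq' : (2 * (g + 1) : ℤ) = q := hq.symm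
      have hg : (g : ℤ) * 2 = q - 2 := by rw [hq]; ring
      rw [hq']
      linear_combination q ^ 4 * ih + (q ^ 2 + 1) * (q ^ 3 + q ^ 2 + q + 1) * hg
  have h := key k le_rfl
  have f0 : e (4 * k + 4) = 1 := by rw [gg _ (by omega) (by omega)]; omega
  unfold seed
  rw [hm, show 4 * k + 6 = 4 * k + 4 + 1 + 1 by ring, AA, AA]
  simp only [Nat.zero_add, add_assoc, Nat.reduceAdd, f0, el]
  push_cast
  have hq' : (2 * (g + 1) : ℤ) = q := hq.symm
  have hg : (g : ℤ) * 2 = q - 2 := by rw [hq]; ring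
  rw [hq']
  simp only [pow_add]
  linear_combination q ^ 2 * h + (q ^ 2 + 1) * (q + 1) * hg

lemma seed3_closed (g k : ℕ) (q : ℤ) (hq : q = 2 * (g + 1)) :
    (seed g (4 * k + 10) (ext (4 * k + 10) (w2 (4 * k + 10))) : ℤ) =
    seed g (4 * k + 10) (ext (4 * k + 10) (w3 (4 * k + 10))) + q * (q - 1) * (q ^ 2 - 1) := by
  set m := 4 * k + 10 with hm
  have hl2 : ∀ j < m, ext m (w2 m) j = w2 m j := fun j hj => ext_low _ hj
  have hl3 : ∀ j < m, ext m (w3 m) j = w3 m j := fun j hj => ext_low _ hj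
  have hA := AA_congr (2 * (g + 1)) (fun j => g + ext m (w2 m) j) (fun j => g + ext m (w3 m) j)
    (4 * k + 5) (fun j hj => by
      rw [hl2 j (by omega), hl3 j (by omega)]
      unfold w2 w3; split_ifs <;> omega)
  generalize ext m (w2 m) = e at *
  generalize ext m (w3 m) = e' at *
  have a5 : e (4 * k + 5) = 1 := by rw [hl2 _ (by omega)]; unfold w2; split_ifs <;> omega
  have a6 : e (4 * k + 6) = 0 := by rw [hl2 _ (by omega)]; unfold w2; split_ifs <;> omega
  have a7 : e (4 * k + 7) = 0 := by rw [hl2 _ (by omega)]; unfold w2; split_ifs <;> omega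
  have a8 : e (4 * k + 8) = 1 := by rw [hl2 _ (by omega)]; unfold w2; split_ifs <;> omega
  have a9 : e (4 * k + 9) = 0 := by rw [hl2 _ (by omega)]; unfold w2; split_ifs <;> omega
  have b5 : e' (4 * k + 5) = 0 := by rw [hl3 _ (by omega)]; unfold w3; split_ifs <;> omega
  have b6 : e' (4 * k + 6) = 1 := by rw [hl3 _ (by omega)]; unfold w3; split_ifs <;> omega
  have b7 : e' (4 * k + 7) = 1 := by rw [hl3 _ (by omega)]; unfold w3; split_ifs <;> omega
  have b8 : e' (4 * k + 8) = 0 := by rw [hl3 _ (by omega)]; unfold w3; split_ifs <;> omega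
  have b9 : e' (4 * k + 9) = 0 := by rw [hl3 _ (by omega)]; unfold w3; split_ifs <;> omega
  unfold seed
  have hx : ∀ D : ℕ → ℕ, AA (2*(g+1)) D (4*k+10) 0 = 2*(g+1)*(2*(g+1)*(2*(g+1)*(2*(g+1)*(2*(g+1)*
      AA (2*(g+1)) D (4*k+5) 0 + D (0+(4*k+5))) + D (0+(4*k+6))) + D (0+(4*k+7)))
      + D (0+(4*k+8))) + D (0+(4*k+9)) := fun D => rfl
  rw [hm, hx, hx]
  simp only [Nat.zero_add, a5, a6, a7, a8, a9, b5, b6, b7, b8, b9]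
  rw [hA]
  push_cast
  have hq' : (2 * (g + 1) : ℤ) = q := hq.symm
  rw [hq']
  ring

lemma seed3_closed' (g : ℕ) (q : ℤ) (hq : q = 2 * (g + 1)) :
    (seed g 6 (ext 6 (w2 6)) : ℤ) = seed g 6 (ext 6 w3') + (q - 1) * q ^ 2 := by
  simp [seed, AA, ext, w2, w3']
  rw [hq]; ring

theorem stmt_2 (q m n : ℕ) (hq : ∃ e : ℕ, 0 < e ∧ q = 2 ^ e)
    (hm4 : m % 4 = 2) (hm : 6 ≤ m) (hn : n = q ^ m + 1)
    (δ2 δ3 : ℕ)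
    (h2 : δ2 = q * (q - 1) * (q ^ m - 2 * q ^ (m - 4) - 1) / (2 * (q ^ 2 + 1)))
    (h3 : (m = 6 → δ3 = δ2 - (q - 1) * q ^ 2) ∧
          (6 < m → δ3 = δ2 - q * (q - 1) * (q ^ 2 - 1))) :
    nthLargestCosetLeader q n 2 = δ2 ∧ nthLargestCosetLeader q n 3 = δ3 ∧
    (cycCoset q n δ2).card = 2 * m ∧ (cycCoset q n δ3).card = 2 * m := by
  obtain ⟨g, rfl⟩ : ∃ g, q = 2 * (g + 1) := by
    obtain ⟨e, he, rfl⟩ := hq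
    obtain ⟨f, rfl⟩ : ∃ f, e = f + 1 := ⟨e - 1, by omega⟩
    have : 0 < 2 ^ f := by positivity
    exact ⟨2 ^ f - 1, by rw [Nat.sub_add_cancel this, pow_succ]; ring⟩
  clear hq
  have hd2 : δ2 = seed g m (ext m (w2 m)) := by
    obtain ⟨k, rfl⟩ : ∃ k, m = 4 * k + 6 := ⟨(m - 6) / 4, by omega⟩
    have hc := seed2_closed g k (2 * (g + 1)) rfl
    rw [h2]
    apply Nat.div_eq_of_eq_mul_right (by positivity)
    have hp : 2 * (2 * (g + 1)) ^ (4 * k + 2) + 1 ≤ (2 * (g + 1)) ^ (4 * k + 6) := by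
      have h1 : 0 < (2 * (g + 1)) ^ (4 * k + 2) := by positivity
      have h2 : 2 ^ 4 ≤ (2 * (g + 1)) ^ 4 := Nat.pow_le_pow_left (by omega) 4
      have h3 : (2 * (g + 1)) ^ (4 * k + 6) = (2 * (g + 1)) ^ (4 * k + 2) * (2 * (g + 1)) ^ 4 := by
        rw [← pow_add]
      rw [h3]; nlinarith
    rw [show 4 * k + 6 - 4 = 4 * k + 2 by omega, Nat.sub_sub]
    zify [hp, show 1 ≤ 2 * (g + 1) by omega]
    rw [hc]; ring
  by_cases h6 : m = 6
  · subst h6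
    have hd3 : δ3 = seed g 6 (ext 6 w3') := by
      have hc := seed3_closed' g (2 * (g + 1)) rfl
      have hc' : seed g 6 (ext 6 (w2 6)) = seed g 6 (ext 6 w3') + (2 * (g + 1) - 1) * (2 * (g + 1)) ^ 2 := by
        zify [show 1 ≤ 2 * (g + 1) by omega]; exact hc
      rw [h3.1 rfl, hd2]; omega
    rw [hd2, hd3]
    refine assemble hn hm4 (anti_w2 (by omega)) anti_w3' strict_w26 strict_w36
      ⟨2, by decide, by decide⟩ ⟨3, by decide, by decide⟩ ?_
    intro b hb t ht hag hlt
    have := comb6 hb t ht (fun u hu => by rw [hag u hu, ext_low _ (by omega)])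
      (by rwa [ext_low _ ht] at hlt)
    refine this.imp id (fun h j hj => ?_)
    rw [h j hj, ext_low _ hj]
  · have hd3 : δ3 = seed g m (ext m (w3 m)) := by
      obtain ⟨k, rfl⟩ : ∃ k, m = 4 * k + 10 := ⟨(m - 10) / 4, by omega⟩
      have hc := seed3_closed g k (2 * (g + 1)) rfl
      have hp : 1 ≤ (2 * (g + 1)) ^ 2 := Nat.one_le_pow _ _ (by omega)
      have hc' : seed g (4 * k + 10) (ext (4 * k + 10) (w2 (4 * k + 10))) =
          seed g (4 * k + 10) (ext (4 * k + 10) (w3 (4 * k + 10))) +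
          2 * (g + 1) * (2 * (g + 1) - 1) * ((2 * (g + 1)) ^ 2 - 1) := by
        zify [show 1 ≤ 2 * (g + 1) by omega, hp]; exact hc
      rw [h3.2 (by omega), hd2]; omega
    rw [hd2, hd3]
    have hm10 : 10 ≤ m := by omega
    refine assemble hn hm4 (anti_w2 (by omega)) (anti_w3 (by omega)) (strict_w2 hm4 hm10)
      (strict_w3 hm4 hm10) ⟨m - 5, ?_, ?_⟩ ⟨3, ?_, ?_⟩ ?_
    · intro u hu
      rw [ext_low _ (by omega), ext_low _ (by omega)]
      unfold w2 w3; split_ifs <;> omega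
    · rw [ext_low _ (by omega), ext_low _ (by omega)]
      unfold w2 w3; split_ifs <;> omega
    · intro u hu
      rw [ext_low _ (by omega)]
      unfold w2 w1; split_ifs <;> omega
    · rw [ext_low _ (by omega)]
      unfold w2 w1; split_ifs <;> omega
    · intro b hb t ht hag hlt
      have := comb10 hb hm4 hm10 t ht (fun u hu => by rw [hag u hu, ext_low _ (by omega)])
        (by rwa [ext_low _ ht] at hlt)
      refine this.imp id (fun h j hj => ?_)
      rw [h j hj, ext_low _ hj]
end

section
/- Let q be an even prime power (a power of 2), let m ≡ 2 (mod 4) with m ≥ 2, and let n = q^m + 1. Let δ be an integer. If δ_{2,n} + 1 ≤ δ ≤ δ_{1,n}, then the union C_1 ∪ C_2 ∪ ... ∪ C_{δ-1} of q-cyclotomic cosets modulo n has cardinality n - 5 (equivalently, the narrow-sense BCH code C_{(n,q,δ,1)} has dimension 5 and the code C_{(n,q,δ+1,0)} has dimension 4). If δ_{3,n} + 1 ≤ δ ≤ δ_{2,n}, then C_1 ∪ C_2 ∪ ... ∪ C_{δ-1} has cardinality n - (2m+5) (equivalently, C_{(n,q,δ,1)} has dimension 2m+5 and C_{(n,q,δ+1,0)}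 has dimension 2m+4). -/
def PP (q n s : ℤ) (j : ℕ) (Z : ℤ) : Prop :=
  Odd Z ∧ 0 ≤ Z ∧ Z ≤ n ∧ (n ∣ Z - 2 * s * q ^ j ∨ n ∣ Z + 2 * s * q ^ j)

theorem PP.step1 {q n s : ℤ} {j : ℕ} {Z : ℤ} (hq : Even q) (hq0 : 0 ≤ q) (hn : Odd n)
    (h : PP q n s j Z) (hW : 0 ≤ n - q * Z) : PP q n s (j + 1) (n - q * Z) := by
  obtain ⟨h1, h2, h3, h4⟩ := h
  refine ⟨hn.sub_even (hq.mul_right Z), hW, by nlinarith, ?_⟩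
  rcases h4 with ⟨c, hc⟩ | ⟨c, hc⟩
  · right; exact ⟨1 - q * c, by rw [pow_succ]; linear_combination (-q) * hc⟩
  · left; exact ⟨1 - q * c, by rw [pow_succ]; linear_combination (-q) * hc⟩

theorem PP.step2 {q n s : ℤ} {j : ℕ} {Z : ℤ} (hq : Even q) (hn : Odd n)
    (h : PP q n s j Z) (hW : 0 ≤ q * Z - n) (hW2 : q * Z - n ≤ n) :
    PP q n s (j + 1) (q * Z - n) := by
  obtain ⟨h1, h2, h3, h4⟩ := h
  refine ⟨(hq.mul_right Z).sub_odd hn, hW, hW2, ?_⟩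
  rcases h4 with ⟨c, hc⟩ | ⟨c, hc⟩
  · left; exact ⟨q * c - 1, by rw [pow_succ]; linear_combination q * hc⟩
  · right; exact ⟨q * c - 1, by rw [pow_succ]; linear_combination q * hc⟩

theorem PP.uniq {q n s : ℤ} {j : ℕ} {Z W : ℤ} (hn0 : 0 < n) (hn : Odd n)
    (h : PP q n s j Z) (h' : PP q n s j W) : Z = W := by
  obtain ⟨h1, h2, h3, h4⟩ := h
  obtain ⟨k1, k2, k3, k4⟩ := h'
  have key : n ∣ Z - W ∨ n ∣ Z + W := by
    rcases h4 with ⟨c, hc⟩ | ⟨c, hc⟩ <;> rcases k4 with ⟨d, hd⟩ | ⟨d, hd⟩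
    · left; exact ⟨c - d, by linear_combination hc - hd⟩
    · right; exact ⟨c + d, by linear_combination hc + hd⟩
    · right; exact ⟨c + d, by linear_combination hc + hd⟩
    · left; exact ⟨c - d, by linear_combination hc - hd⟩
  rcases key with ⟨c, hc⟩ | ⟨c, hc⟩
  · have e : Even (n * c) := hc ▸ h1.sub_odd k1
    have e2 : Even c := by
      rcases Int.even_mul.1 e with e | e
      · exact absurd e (Int.not_even_iff_odd.2 hn)
      · exact e
    obtain ⟨d, rfl⟩ := e2
    have : d < 1 := by by_contra hh; nlinarith
    have : -1 < d := by by_contra hh; nlinarith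
    have : d = 0 := by omega
    subst this; linarith
  · have e : Even (n * c) := hc ▸ h1.add_odd k1
    have e2 : Even c := by
      rcases Int.even_mul.1 e with e | e
      · exact absurd e (Int.not_even_iff_odd.2 hn)
      · exact e
    obtain ⟨d, rfl⟩ := e2
    have a1 : d < 2 := by by_contra hh; nlinarith
    have a2 : -1 < d := by by_contra hh; nlinarith
    have : d = 0 ∨ d = 1 := by omega
    rcases this with rfl | rfl <;> linarith

/-- No leader lies above the first one. -/
theorem claimLow {q n s h : ℤ} (hq : Even q) (hq2 : 2 ≤ q) (hn : Odd n) (hh : 0 < h)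
    (hnh : n = (q ^ 2 + 1) * h) (hnd : ¬ (q + 1 ∣ n)) {Z : ℤ} (h0 : PP q n s 0 Z)
    (HL : ∀ j W, PP q n s j W → W ≤ Z) : (q + 1) * h ≤ Z := by
  by_contra hlt
  push Not at hlt
  have hq0 : 0 ≤ q := by linarith
  by_cases hc : n ≤ q * Z
  · have p1 := h0.step2 hq hn (by linarith) (by
      have : q * Z ≤ q * ((q + 1) * h) := by gcongr
      nlinarith [mul_nonneg (mul_nonneg hq0 (by linarith : 0 ≤ q - 1)) hh.le])
    have : q * Z < q * ((q + 1) * h) := by gcongr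
    have l1 : q * Z - n ≤ (q - 1) * h := by rw [hnh] at *; nlinarith
    have l2 : q * (q * Z - n) ≤ q * ((q - 1) * h) := by gcongr
    have p2 := p1.step1 hq hq0 hn (by rw [hnh] at *; nlinarith [mul_nonneg hq0 hh.le])
    have := HL _ _ p2
    have : (q + 1) * n ≤ (q ^ 2 + 1) * Z := by nlinarith
    have : (q ^ 2 + 1) * Z < (q ^ 2 + 1) * ((q + 1) * h) := by gcongr
    rw [hnh] at *; nlinarith
  · push Not at hc
    have p1 := h0.step1 hq hq0 hn (by linarith)
    have a1 := HL _ _ p1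
    have l2 : q * (n - q * Z) ≤ q * Z := by gcongr
    have p2 := p1.step1 hq hq0 hn (by linarith)
    have a2 := HL _ _ p2
    have a3 : (q - 1) * ((q + 1) * Z) ≤ (q - 1) * n := by nlinarith
    have a4 : (q + 1) * Z ≤ n := le_of_mul_le_mul_left a3 (by linarith)
    exact hnd ⟨Z, by linarith⟩

/-- Just below the first leader there is nothing. -/
theorem claimU {q n s h : ℤ} (hq : Even q) (hq2 : 2 ≤ q) (hn : Odd n) (hh : 0 < h)
    (hnh : n = (q ^ 2 + 1) * h) (K : ℕ) {Z : ℤ} (h0 : PP q n s 0 Z)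
    (hK : PP q n s (4 * K + 2) Z)
    (HL : ∀ j W, PP q n s j W → W ≤ Z) (hlo : (q + 1) * h ≤ Z)
    (hhi : q ^ 3 * (Z - (q + 1) * h) < 2 * (q - 1) * h) : Z = (q + 1) * h := by
  have hq0 : 0 ≤ q := by linarith
  have hn0 : 0 < n := by rw [hnh]; positivity
  obtain ⟨u, hu⟩ : ∃ u, u = Z - (q + 1) * h := ⟨_, rfl⟩
  have hZ : Z = (q + 1) * h + u := by linarith
  have hu0 : 0 ≤ u := by linarith
  rw [← hu] at hhi
  have base : ∀ (v : ℤ) (j : ℕ), 0 ≤ v → v ≤ u → PP q n s j ((q + 1) * h + v) →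
      PP q n s (j + 2) ((q + 1) * h - q ^ 2 * v) ∧
      q ^ 3 * v < 2 * (q - 1) * h := by
    intro v j hv0 hvu hp
    have hv : q ^ 3 * v < 2 * (q - 1) * h := by
      have : q ^ 3 * v ≤ q ^ 3 * u := by gcongr
      linarith
    have hqh : 0 ≤ q * h := by positivity
    have b2 : q ^ 2 * v ≤ (q - 1) * h := by
      have : 2 * (q ^ 2 * v) ≤ q * (q ^ 2 * v) := by
        have : 0 ≤ q ^ 2 * v := by positivity
        nlinarith
      nlinarith
    have b1 : q * v ≤ (q - 1) * h := by
      have : q * v ≤ q ^ 2 * v := by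
        have : 0 ≤ q * v := by positivity
        nlinarith
      linarith
    have p1 := hp.step2 hq hn (by rw [hnh]; nlinarith [mul_nonneg hq0 hv0]) (by rw [hnh]; nlinarith [mul_nonneg hqh hq0])
    have e1 : q * ((q + 1) * h + v) - n = (q - 1) * h + q * v := by rw [hnh]; ring
    rw [e1] at p1
    have e2 : n - q * ((q - 1) * h + q * v) = (q + 1) * h - q ^ 2 * v := by rw [hnh]; ring
    have p2 := p1.step1 hq hq0 hn (by rw [e2]; nlinarith)
    rw [e2] at p2
    exact ⟨p2, hv⟩
  have main : ∀ k : ℕ, ∃ v, 0 ≤ v ∧ v ≤ u ∧ PP q n s (4 * k) ((q + 1) * h + v) := by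
    intro k
    induction k with
    | zero => exact ⟨u, hu0, le_rfl, by rw [← hZ]; exact h0⟩
    | succ k ih =>
      obtain ⟨v, hv0, hvu, hp⟩ := ih
      obtain ⟨p2, hv⟩ := base v _ hv0 hvu hp
      have hqh : 0 ≤ q * h := by positivity
      have hq3 : 0 ≤ q ^ 3 * v := by positivity
      have hq4 : q * (q ^ 3 * v) ≤ q * (2 * (q - 1) * h) := by gcongr
      rcases le_total (q ^ 3 * v) ((q - 1) * h) with hc | hc
      · have e3 : q * ((q + 1) * h - q ^ 2 * v) - n = (q - 1) * h - q ^ 3 * v := by rw [hnh]; ring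
        have p3 := p2.step2 hq hn (by rw [e3]; linarith) (by rw [e3, hnh]; nlinarith [mul_nonneg hqh hq0])
        rw [e3] at p3
        have e4 : n - q * ((q - 1) * h - q ^ 3 * v) = (q + 1) * h + q ^ 4 * v := by rw [hnh]; ring
        have p4 := p3.step1 hq hq0 hn (by rw [e4]; positivity)
        rw [e4] at p4
        have := HL _ _ p4
        exact ⟨q ^ 4 * v, by positivity, by linarith, p4⟩
      · have e3 : n - q * ((q + 1) * h - q ^ 2 * v) = q ^ 3 * v - (q - 1) * h := by rw [hnh]; ring
        have p3 := p2.step1 hq hq0 hn (by rw [e3]; linarith)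
        rw [e3] at p3
        have e4 : n - q * (q ^ 3 * v - (q - 1) * h) =
          (q + 1) * h + q * (2 * (q - 1) * h - q ^ 3 * v) := by rw [hnh]; ring
        have t : 0 ≤ q * (2 * (q - 1) * h - q ^ 3 * v) := mul_nonneg hq0 (by linarith)
        have p4 := p3.step1 hq hq0 hn (by rw [e4]; positivity)
        rw [e4] at p4
        have := HL _ _ p4
        exact ⟨_, t, by linarith, p4⟩
  obtain ⟨v, hv0, hvu, hp⟩ := main K
  obtain ⟨p2, _⟩ := base v _ hv0 hvu hp
  have := p2.uniq hn0 hn hK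
  have : 0 ≤ q ^ 2 * v := by positivity
  linarith

/-- The orbit of the first leader. -/
theorem orbit1 {q n s h : ℤ} (hq : Even q) (hq2 : 2 ≤ q) (hn : Odd n) (hh : 0 < h)
    (hnh : n = (q ^ 2 + 1) * h) (h0 : PP q n s 0 ((q + 1) * h)) (j : ℕ) :
    ∃ W, PP q n s j W ∧ W ≤ (q + 1) * h := by
  have hq0 : 0 ≤ q := by linarith
  have hqh : 0 ≤ q * h := by positivity
  have : PP q n s j ((q + 1) * h) ∨ PP q n s j ((q - 1) * h) := by
    induction j with
    | zero => exact Or.inl h0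
    | succ j ih =>
      rcases ih with p | p
      · right
        have e : q * ((q + 1) * h) - n = (q - 1) * h := by rw [hnh]; ring
        have := p.step2 hq hn (by rw [e]; nlinarith) (by rw [e, hnh]; nlinarith [mul_nonneg hqh hq0])
        rwa [e] at this
      · left
        have e : n - q * ((q - 1) * h) = (q + 1) * h := by rw [hnh]; ring
        have := p.step1 hq hq0 hn (by rw [e]; positivity)
        rwa [e] at this
  rcases this with p | p
  · exact ⟨_, p, le_rfl⟩
  · exact ⟨_, p, by nlinarith⟩

set_option maxHeartbeats 2000000 in
/-- The orbit of the second leader. -/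
theorem orbit2 {q n s h g : ℤ} (hq : Even q) (hq2 : 2 ≤ q) (hn : Odd n) (hh : 0 < h) (hg : 0 < g)
    (hnh : n = (q ^ 2 + 1) * h) (hhg : h = q ^ 4 * g - (q ^ 2 - 1)) (K : ℕ)
    (hgK : (q ^ 2 + 1) * g = q ^ (4 * K + 2) + 1)
    (h0 : PP q n s 0 ((q + 1) * h + 2 * q * (q - 1) * g)) (j : ℕ) (hj0 : 0 < j)
    (hj : j < 4 * K + 6) :
    ∃ W, PP q n s j W ∧ W < (q + 1) * h + 2 * q * (q - 1) * g := by
  have hq0 : 0 ≤ q := by linarith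
  have hqh : 0 < q * h := by positivity
  have hqg : 0 < q * g := by positivity
  have hq1 : 0 ≤ q - 1 := by linarith
  have hu0 : 0 < q * (q - 1) * g := by nlinarith
  have hq2g : q ^ 2 - 1 ≤ q ^ 2 * g := by nlinarith [mul_nonneg (sq_nonneg q) (by linarith : 0 ≤ g - 1)]
  have hg3 : q ^ 3 * g ≤ h := by
    rw [hhg]
    have : 2 * (q ^ 3 * g) ≤ q * (q ^ 3 * g) := by
      have : 0 ≤ q ^ 3 * g := by positivity
      nlinarith
    have : 2 * (q ^ 2 * g) ≤ q * (q ^ 2 * g) := by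
      have : 0 ≤ q ^ 2 * g := by positivity
      nlinarith
    have : 0 ≤ q ^ 2 * g := by positivity
    nlinarith
  have hg2 : q ^ 2 * g ≤ h := by
    have : q ^ 2 * g ≤ q * (q ^ 2 * g) := by
      have : 0 ≤ q ^ 2 * g := by positivity
      nlinarith
    nlinarith
  have p1 : PP q n s 1 ((q - 1) * h + 2 * q ^ 2 * (q - 1) * g) := by
    have e : q * ((q + 1) * h + 2 * q * (q - 1) * g) - n
      = (q - 1) * h + 2 * q ^ 2 * (q - 1) * g := by rw [hnh]; ring
    have := h0.step2 hq hn (by rw [e]; positivity) (by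
      rw [e, hnh]
      have : (q - 1) * (2 * (q ^ 2 * g)) ≤ (q - 1) * (2 * h) := by gcongr
      have : 0 ≤ (q - 1) ^ 2 * h := by positivity
      nlinarith)
    rwa [e] at this
  have p2 : PP q n s 2 ((q + 1) * h - 2 * q ^ 3 * (q - 1) * g) := by
    have e : n - q * ((q - 1) * h + 2 * q ^ 2 * (q - 1) * g)
      = (q + 1) * h - 2 * q ^ 3 * (q - 1) * g := by rw [hnh]; ring
    have := p1.step1 hq hq0 hn (by
      rw [e]
      have t1 : (q + 1) * (q ^ 4 * g - q ^ 2 * g) ≤ (q + 1) * h := by gcongr; linarith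
      have t2 : 0 ≤ q ^ 2 * g * (q - 1) * (q ^ 2 + 1) := by positivity
      nlinarith)
    rwa [e] at this
  have p3 : PP q n s 3 ((q - 1) * h + 2 * (q - 1) * (q ^ 2 - 1)) := by
    have e : n - q * ((q + 1) * h - 2 * q ^ 3 * (q - 1) * g)
      = (q - 1) * h + 2 * (q - 1) * (q ^ 2 - 1) := by rw [hnh, hhg]; ring
    have := p2.step1 hq hq0 hn (by
      rw [e]; have : 0 ≤ q ^ 2 - 1 := by nlinarith
      positivity)
    rwa [e] at this
  have hT : ∀ k ≤ K, 0 < q ^ (4 * k) * (q ^ 2 - 1) ∧ q ^ 2 * (q ^ (4 * k) * (q ^ 2 - 1)) ≤ h := by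
    intro k hk
    obtain ⟨i, rfl⟩ := Nat.exists_eq_add_of_le hk
    have hE : 0 < q ^ (4 * k) := by positivity
    have hq21 : 0 < q ^ 2 - 1 := by nlinarith
    have hR : 1 ≤ q ^ (4 * i) := one_le_pow₀ (by linarith)
    refine ⟨by positivity, ?_⟩
    have e : (q ^ 2 + 1) * h = q ^ (4 * k) * q ^ (4 * i) * q ^ 6 + 1 := by
      have : q ^ (4 * (k + i) + 2) = q ^ (4 * k) * q ^ (4 * i) * q ^ 2 := by ring
      rw [this] at hgK
      rw [hhg]; linear_combination q ^ 4 * hgK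
    have t : q ^ (4 * k) * 1 * q ^ 6 ≤ q ^ (4 * k) * q ^ (4 * i) * q ^ 6 := by gcongr
    have t2 : 0 ≤ q ^ (4 * k) * q ^ 2 := by positivity
    refine le_of_mul_le_mul_left (a := q ^ 2 + 1) ?_ (by positivity)
    nlinarith
  have hT2 : ∀ k < K, q ^ 6 * (q ^ (4 * k) * (q ^ 2 - 1)) ≤ h ∧
      q ^ 2 * (q ^ (4 * k) * (q ^ 2 - 1)) < g := by
    intro k hk
    have a := (hT (k + 1) hk).2
    have e : q ^ (4 * (k + 1)) = q ^ (4 * k) * q ^ 4 := by ring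
    rw [e] at a
    refine ⟨by nlinarith, ?_⟩
    have hq21 : 0 < q ^ 2 - 1 := by nlinarith
    have : q ^ 4 * (q ^ 2 * (q ^ (4 * k) * (q ^ 2 - 1))) < q ^ 4 * g := by nlinarith
    exact lt_of_mul_lt_mul_left this (by positivity)
  -- a block, generic part
  have blk : ∀ (T : ℤ) (i : ℕ), 0 < T → q ^ 2 * T ≤ h → PP q n s i ((q - 1) * h + 2 * (q - 1) * T) →
      PP q n s (i + 1) ((q + 1) * h - 2 * q * (q - 1) * T) ∧
      (q - 1) * h + 2 * (q - 1) * T < (q + 1) * h := by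
    intro T i hT0 hTh hp
    have hqT : 0 < q * T := by positivity
    have e : n - q * ((q - 1) * h + 2 * (q - 1) * T) = (q + 1) * h - 2 * q * (q - 1) * T := by
      rw [hnh]; ring
    have := hp.step1 hq hq0 hn (by rw [e]; nlinarith)
    rw [e] at this
    refine ⟨this, ?_⟩
    nlinarith [mul_nonneg hqT.le hq1, mul_nonneg hq1 hq1, mul_nonneg (mul_nonneg hq1 hq1) hT0.le]
  have blk2 : ∀ (T : ℤ) (i : ℕ), 0 < T → q ^ 6 * T ≤ h →
      PP q n s i ((q - 1) * h + 2 * (q - 1) * T) →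
      PP q n s (i + 2) ((q - 1) * h - 2 * q ^ 2 * (q - 1) * T) ∧
      PP q n s (i + 3) ((q + 1) * h + 2 * q ^ 3 * (q - 1) * T) ∧
      PP q n s (i + 4) ((q - 1) * h + 2 * (q - 1) * (q ^ 4 * T)) := by
    intro T i hT0 hTh hp
    have m4 : 4 * (q ^ 4 * T) ≤ h := by
      have : 2 ^ 2 * (q ^ 4 * T) ≤ q ^ 2 * (q ^ 4 * T) := by gcongr
      nlinarith
    have m2 : 4 * (q ^ 2 * T) ≤ q ^ 4 * T := by
      have : 2 ^ 2 * (q ^ 2 * T) ≤ q ^ 2 * (q ^ 2 * T) := by gcongr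
      nlinarith
    have hq2T : 0 < q ^ 2 * T := by positivity
    obtain ⟨w4, -⟩ := blk T i hT0 (by linarith) hp
    have hqq : 0 ≤ (q - 1) ^ 2 * h := by positivity
    have n2 : (q - 1) * (4 * (q ^ 2 * T)) ≤ (q - 1) * h := by gcongr; linarith
    have n4 : (q - 1) * (4 * (q ^ 4 * T)) ≤ (q - 1) * h := by gcongr
    have e5 : q * ((q + 1) * h - 2 * q * (q - 1) * T) - n
      = (q - 1) * h - 2 * q ^ 2 * (q - 1) * T := by rw [hnh]; ring
    have z5 : 0 ≤ (q - 1) * (q ^ 2 * T) := by positivity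
    have w5 := w4.step2 hq hn (by rw [e5]; nlinarith) (by rw [e5, hnh]; nlinarith)
    rw [e5] at w5
    have e6 : n - q * ((q - 1) * h - 2 * q ^ 2 * (q - 1) * T)
      = (q + 1) * h + 2 * q ^ 3 * (q - 1) * T := by rw [hnh]; ring
    have w6 := w5.step1 hq hq0 hn (by rw [e6]; positivity)
    rw [e6] at w6
    have e7 : q * ((q + 1) * h + 2 * q ^ 3 * (q - 1) * T) - n
      = (q - 1) * h + 2 * (q - 1) * (q ^ 4 * T) := by rw [hnh]; ring
    have w7 := w6.step2 hq hn (by rw [e7]; positivity) (by rw [e7, hnh]; nlinarith)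
    rw [e7] at w7
    exact ⟨w5, w6, w7⟩
  have blocks : ∀ k ≤ K,
      PP q n s (3 + 4 * k) ((q - 1) * h + 2 * (q - 1) * (q ^ (4 * k) * (q ^ 2 - 1))) := by
    intro k
    induction k with
    | zero => intro _; convert p3 using 1; ring
    | succ k ih =>
      intro hk
      have := (blk2 _ _ (hT k (by omega)).1 (hT2 k (by omega)).1 (ih (by omega))).2.2
      have e : q ^ (4 * (k + 1)) = q ^ 4 * q ^ (4 * k) := by ring
      rw [e, mul_assoc (q ^ 4)]
      exact this
  have hcase : j = 1 ∨ j = 2 ∨ ∃ k ≤ K, j = 3 + 4 * k ∨ j = 3 + 4 * k + 1 ∨ j = 3 + 4 * k + 2 ∨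
      (k < K ∧ j = 3 + 4 * k + 3) := by
    by_cases h1 : j = 1
    · exact Or.inl h1
    by_cases h2 : j = 2
    · exact Or.inr (Or.inl h2)
    exact Or.inr (Or.inr ⟨(j - 3) / 4, by omega, by omega⟩)
  rcases hcase with rfl | rfl | ⟨k, hk, hcase⟩
  · refine ⟨_, p1, ?_⟩
    have : (q - 1) * (q ^ 2 * g) ≤ h := by nlinarith
    nlinarith
  · refine ⟨_, p2, ?_⟩
    have : 0 ≤ q ^ 3 * (q - 1) * g := by positivity
    nlinarith
  · obtain ⟨t0, t1⟩ := hT k hk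
    have b := blocks k hk
    have hK2 := hT2 k
    generalize q ^ (4 * k) * (q ^ 2 - 1) = T at *
    obtain ⟨w4, l3⟩ := blk T _ t0 t1 b
    have z4 : 0 ≤ q * (q - 1) * T := by positivity
    rcases hcase with rfl | rfl | rfl | ⟨hk', rfl⟩
    · exact ⟨_, b, by nlinarith⟩
    · exact ⟨_, w4, by nlinarith⟩
    · have z5 : (q - 1) * (q ^ 2 * T) ≤ (q - 1) * h := by gcongr
      have z6 : 0 ≤ (q - 1) * (q ^ 2 * T) := by positivity
      have hqq : 0 ≤ (q - 1) ^ 2 * h := by positivity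
      rcases le_total 0 ((q - 1) * h - 2 * q ^ 2 * (q - 1) * T) with hc | hc
      · have e5 : q * ((q + 1) * h - 2 * q * (q - 1) * T) - n
          = (q - 1) * h - 2 * q ^ 2 * (q - 1) * T := by rw [hnh]; ring
        have w5 := w4.step2 hq hn (by rw [e5]; linarith) (by rw [e5, hnh]; nlinarith)
        exact ⟨_, w5, by rw [e5]; nlinarith⟩
      · have e5 : n - q * ((q + 1) * h - 2 * q * (q - 1) * T)
          = 2 * q ^ 2 * (q - 1) * T - (q - 1) * h := by rw [hnh]; ring
        have w5 := w4.step1 hq hq0 hn (by rw [e5]; linarith)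
        exact ⟨_, w5, by rw [e5]; nlinarith⟩
    · obtain ⟨-, w6, -⟩ := blk2 T _ t0 (hK2 hk').1 b
      refine ⟨_, w6, ?_⟩
      have : q * (q - 1) * (q ^ 2 * T) < q * (q - 1) * g :=
        mul_lt_mul_of_pos_left (hK2 hk').2 (by nlinarith)
      nlinarith

section cosets
variable {q n : ℕ}

theorem mem_cyc (hn : 1 < n) (hc : Nat.Coprime q n) {s x : ℕ} :
    x ∈ cycCoset q n s ↔ ∃ j, x = s * q ^ j % n := by
  have : NeZero n := ⟨by omega⟩
  have hpos : 0 < orderOf (q : ZMod n) := by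
    have := orderOf_pos (ZMod.unitOfCoprime q hc)
    rwa [← orderOf_units, ZMod.coe_unitOfCoprime] at this
  unfold cycCoset
  simp only [Finset.mem_image, Finset.mem_range]
  constructor
  · rintro ⟨j, _, rfl⟩; exact ⟨j, rfl⟩
  · rintro ⟨j, rfl⟩
    refine ⟨j % orderOf (q : ZMod n), Nat.mod_lt _ hpos, ?_⟩
    have : ((s * q ^ (j % orderOf (q : ZMod n)) : ℕ) : ZMod n) = ((s * q ^ j : ℕ) : ZMod n) := by
      push_cast
      rw [pow_mod_orderOf]
    exact (ZMod.natCast_eq_natCast_iff' _ _ _).1 this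

theorem cyc_trans (hn : 1 < n) (hc : Nat.Coprime q n) {s x y : ℕ}
    (h1 : x ∈ cycCoset q n s) (h2 : y ∈ cycCoset q n x) : y ∈ cycCoset q n s := by
  rw [mem_cyc hn hc] at *
  obtain ⟨i, rfl⟩ := h1
  obtain ⟨j, rfl⟩ := h2
  exact ⟨i + j, by rw [Nat.mod_mul_mod, pow_add, mul_assoc]⟩

theorem cyc_self (hn : 1 < n) (hc : Nat.Coprime q n) {s : ℕ} (hs : s < n) :
    s ∈ cycCoset q n s := (mem_cyc hn hc).2 ⟨0, by simp [Nat.mod_eq_of_lt hs]⟩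

theorem cyc_lt (hn : 1 < n) (hc : Nat.Coprime q n) {s x : ℕ}
    (h1 : x ∈ cycCoset q n s) : x < n := by
  rw [mem_cyc hn hc] at h1
  obtain ⟨i, rfl⟩ := h1
  exact Nat.mod_lt _ (by omega)

theorem cyc_symm (hn : 1 < n) (hc : Nat.Coprime q n) {s x : ℕ} (hs : s < n)
    (h1 : x ∈ cycCoset q n s) : s ∈ cycCoset q n x := by
  have : NeZero n := ⟨by omega⟩
  have hpos : 0 < orderOf (q : ZMod n) := by
    have := orderOf_pos (ZMod.unitOfCoprime q hc)
    rwa [← orderOf_units, ZMod.coe_unitOfCoprime] at this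
  rw [mem_cyc hn hc] at *
  obtain ⟨i, rfl⟩ := h1
  refine ⟨orderOf (q : ZMod n) * i - i, ?_⟩
  rw [Nat.mod_mul_mod, mul_assoc, ← pow_add, Nat.add_sub_cancel' (Nat.le_mul_of_pos_left i hpos)]
  have : ((s * q ^ (orderOf (q : ZMod n) * i) : ℕ) : ZMod n) = ((s : ℕ) : ZMod n) := by
    push_cast
    rw [pow_mul, pow_orderOf_eq_one]; simp
  rw [(ZMod.natCast_eq_natCast_iff' _ _ _).1 this, Nat.mod_eq_of_lt hs]

theorem mem_leaders_s4 {s : ℕ} : s ∈ cosetLeaders q n ↔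
    s < n ∧ s ∈ cycCoset q n s ∧ ∀ x ∈ cycCoset q n s, s ≤ x := by
  simp [cosetLeaders]

theorem exists_leader (hn : 1 < n) (hc : Nat.Coprime q n) {x : ℕ} (hx : x < n) :
    ∃ l ∈ cosetLeaders q n, x ∈ cycCoset q n l ∧ l ∈ cycCoset q n x := by
  obtain ⟨l, hl, hmin⟩ := (cycCoset q n x).exists_min_image id ⟨x, cyc_self hn hc hx⟩
  have hln := cyc_lt hn hc hl
  exact ⟨l, mem_leaders_s4.2 ⟨hln, cyc_self hn hc hln, fun y hy => hmin y (cyc_trans hn hc hl hy)⟩,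
    cyc_symm hn hc hx hl, hl⟩

theorem leader_uniq (hn : 1 < n) (hc : Nat.Coprime q n) {a b x : ℕ}
    (ha : a ∈ cosetLeaders q n) (hb : b ∈ cosetLeaders q n)
    (h1 : x ∈ cycCoset q n a) (h2 : x ∈ cycCoset q n b) : a = b := by
  obtain ⟨a1, a2, a3⟩ := mem_leaders_s4.1 ha
  obtain ⟨b1, b2, b3⟩ := mem_leaders_s4.1 hb
  apply le_antisymm
  · exact a3 _ (cyc_trans hn hc h1 (cyc_symm hn hc b1 h2))
  · exact b3 _ (cyc_trans hn hc h2 (cyc_symm hn hc a1 h1))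

theorem zero_leader (hn : 1 < n) (hc : Nat.Coprime q n) : 0 ∈ cosetLeaders q n :=
  mem_leaders_s4.2 ⟨by omega, cyc_self hn hc (by omega), fun _ _ => Nat.zero_le _⟩

theorem cyc_zero (hn : 1 < n) (hc : Nat.Coprime q n) : cycCoset q n 0 = {0} := by
  ext x; rw [mem_cyc hn hc]; simp

/-- The union of small cosets, up to the large leaders. -/
theorem union_card (hn : 1 < n) (hc : Nat.Coprime q n) (δ : ℕ) (hδ : 1 ≤ δ) (hδn : δ ≤ n) :
    ((Finset.Icc 1 (δ - 1)).biUnion (cycCoset q n)).card +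
      (((cosetLeaders q n).filter fun s => s = 0 ∨ δ ≤ s).biUnion (cycCoset q n)).card = n := by
  rw [← Finset.card_union_of_disjoint]
  · conv_rhs => rw [← Finset.card_range n]
    congr 1
    ext x
    simp only [Finset.mem_union, Finset.mem_biUnion, Finset.mem_Icc, Finset.mem_filter,
      Finset.mem_range]
    constructor
    · rintro (⟨s, -, h⟩ | ⟨s, -, h⟩) <;> exact cyc_lt hn hc h
    · intro hx
      obtain ⟨l, hl, h1, h2⟩ := exists_leader hn hc hx
      by_cases h : l = 0 ∨ δ ≤ l
      · exact Or.inr ⟨l, ⟨hl, h⟩, h1⟩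
      · exact Or.inl ⟨l, by omega, h1⟩
  · rw [Finset.disjoint_left]
    intro x hx hx'
    simp only [Finset.mem_biUnion, Finset.mem_Icc, Finset.mem_filter] at hx hx'
    obtain ⟨s, hs, h1⟩ := hx
    obtain ⟨l, ⟨hl, h⟩, h2⟩ := hx'
    have hxn := cyc_lt hn hc h1
    obtain ⟨l1, l2, l3⟩ := mem_leaders_s4.1 hl
    have hsn : s < n := by omega
    have hsl := cyc_trans hn hc h2 (cyc_symm hn hc hsn h1)
    have := l3 _ hsl
    rcases h with rfl | h
    · rw [cyc_zero hn hc] at hsl; simp at hsl; omega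
    · omega

theorem cyc_card (hn : 1 < n) (hc : Nat.Coprime q n) {s p : ℕ} (hp : 0 < p)
    (h1 : s * q ^ p ≡ s [MOD n]) (h2 : ∀ j, 0 < j → j < p → ¬ s * q ^ j ≡ s [MOD n]) :
    (cycCoset q n s).card = p := by
  have hmul : ∀ k, s * q ^ (p * k) ≡ s [MOD n] := by
    intro k
    induction k with
    | zero => simp; rfl
    | succ k ih =>
      have := (ih.mul_right (q ^ p)).trans h1
      rwa [mul_assoc, ← pow_add, ← Nat.mul_succ] at this
  have : cycCoset q n s = (Finset.range p).image fun j => s * q ^ j % n := by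
    ext x
    rw [mem_cyc hn hc]
    simp only [Finset.mem_image, Finset.mem_range]
    constructor
    · rintro ⟨j, rfl⟩
      refine ⟨j % p, Nat.mod_lt _ hp, ?_⟩
      have := (hmul (j / p)).mul_right (q ^ (j % p))
      rw [mul_assoc, ← pow_add, Nat.div_add_mod] at this
      exact this.symm
    · rintro ⟨j, _, rfl⟩; exact ⟨j, rfl⟩
  rw [this, Finset.card_image_of_injOn, Finset.card_range]
  have key : ∀ i j, i < j → j < p → ¬ s * q ^ i % n = s * q ^ j % n := by
    intro i j hij hj h
    apply h2 (j - i) (by omega) (by omega)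
    have h' : s * q ^ i ≡ s * q ^ (j - i) * q ^ i [MOD n] := by
      rw [mul_assoc, ← pow_add, Nat.sub_add_cancel hij.le]; exact h
    exact (Nat.ModEq.cancel_right_of_coprime (hc.symm.pow_right i) h').symm
  intro i hi j hj h
  simp at hi hj
  rcases lt_trichotomy i j with h' | h' | h'
  · exact absurd h (key _ _ h' hj)
  · exact h'
  · have hcon := key _ _ h' hi
    exact absurd h.symm hcon

/-- Cosets of size four. -/
theorem cyc_card4 (hn : 1 < n) (hc : Nat.Coprime q n) (ho : Odd n) {s : ℕ} (hs : ¬ n ∣ s)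
    (h : n ∣ s * (q ^ 2 + 1)) : (cycCoset q n s).card = 4 := by
  have hcast : ∀ a b : ℕ, a ≡ b [MOD n] ↔ (n : ℤ) ∣ (a : ℤ) - b := fun a b => by
    rw [← Int.natCast_modEq_iff, Int.modEq_comm, Int.modEq_iff_dvd]
  have hz : (n : ℤ) ∣ s * (q ^ 2 + 1) := by exact_mod_cast h
  have no2 : ¬ (n : ℤ) ∣ s * q ^ 2 - s := by
    intro h'
    have : (n : ℤ) ∣ 2 * s := by
      have := dvd_sub hz h'; ring_nf at this; rwa [mul_comm]
    have h3 : n ∣ 2 * s := by exact_mod_cast this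
    exact hs ((Nat.Coprime.dvd_of_dvd_mul_left (by simpa using ho) h3))
  apply cyc_card hn hc (by norm_num)
  · rw [hcast]; push_cast
    obtain ⟨c, hc⟩ := hz
    exact ⟨c * (q ^ 2 - 1), by linear_combination (q ^ 2 - 1 : ℤ) * hc⟩
  · intro j hj0 hj hj'
    rw [hcast] at hj'; push_cast at hj'
    apply no2
    obtain ⟨c, hc⟩ := hz
    obtain ⟨d, hd⟩ := hj'
    interval_cases j
    · exact ⟨(q + 1) * d, by linear_combination (q + 1 : ℤ) * hd⟩
    · exact ⟨d, hd⟩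
    · exact ⟨(q * c - d) * (q - 1), by linear_combination (q - 1 : ℤ) * (q * hc - hd)⟩

end cosets

theorem list_facts (S : Finset ℕ) (l : List ℕ) (hl : l = (S.sort (· ≤ ·)).reverse) :
    l.Pairwise (· > ·) ∧ ∀ x, x ∈ l ↔ x ∈ S := by
  subst hl
  constructor
  · rw [List.pairwise_reverse]
    exact (Finset.sortedLT_sort S).pairwise
  · intro x; simp

section connect
variable {q n m : ℕ}

theorem PP_add {s : ℕ} (hnm : n = q ^ m + 1) {j : ℕ} {Z : ℤ} (h : PP q n s j Z) :
    PP q n s (j + m) Z := by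
  have e : (n : ℤ) = (q : ℤ) ^ m + 1 := by rw [hnm]; push_cast; ring
  obtain ⟨h1, h2, h3, h4⟩ := h
  refine ⟨h1, h2, h3, ?_⟩
  rcases h4 with ⟨c, hc⟩ | ⟨c, hc⟩
  · right; exact ⟨c + 2 * s * q ^ j, by rw [pow_add]; linear_combination hc - 2 * s * (q : ℤ) ^ j * e⟩
  · left; exact ⟨c - 2 * s * q ^ j, by rw [pow_add]; linear_combination hc + 2 * s * (q : ℤ) ^ j * e⟩

theorem PP_add_mul {s : ℕ} (hnm : n = q ^ m + 1) {j : ℕ} {Z : ℤ} (h : PP q n s j Z) (k : ℕ) :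
    PP q n s (j + m * k) Z := by
  induction k with
  | zero => exact h
  | succ k ih => rw [Nat.mul_succ, ← add_assoc]; exact PP_add hnm ih

theorem leader_HL (hn : 1 < n) (hc : Nat.Coprime q n) (ho : Odd n) (hnm : n = q ^ m + 1) {s : ℕ}
    (hs : s ∈ cosetLeaders q n) (j : ℕ) (Z : ℤ) (h : PP q n s j Z) : Z ≤ n - 2 * s := by
  obtain ⟨s1, s2, s3⟩ := mem_leaders_s4.1 hs
  have e : (n : ℤ) = (q : ℤ) ^ m + 1 := by rw [hnm]; push_cast; ring
  obtain ⟨h1, h2, h3, h4⟩ := h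
  have hcop : IsCoprime (n : ℤ) 2 := by
    have := (Nat.isCoprime_iff_coprime (m := n) (n := 2)).2 (by simpa using ho)
    exact_mod_cast this
  have ho' : Odd (n : ℤ) := by exact_mod_cast ho
  obtain ⟨y, hy⟩ := ho'.sub_odd h1
  have hy0 : 0 ≤ y := by omega
  lift y to ℕ using hy0
  have hyn : y < n := by
    obtain ⟨t, ht⟩ := h1
    omega
  have hex : ∃ i : ℕ, (n : ℤ) ∣ s * q ^ i - y := by
    rcases h4 with ⟨c, hc⟩ | ⟨c, hc⟩
    · refine ⟨j + m, hcop.dvd_of_dvd_mul_left ⟨2 * s * q ^ j - (1 - c), ?_⟩⟩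
      rw [pow_add]; linear_combination -2 * s * (q : ℤ) ^ j * e + hc + hy
    · refine ⟨j, hcop.dvd_of_dvd_mul_left ⟨c - 1, ?_⟩⟩
      linear_combination hc + hy
  obtain ⟨i, hi⟩ := hex
  have hmem : y ∈ cycCoset q n s := by
    rw [mem_cyc hn hc]
    refine ⟨i, ?_⟩
    have : y ≡ s * q ^ i [MOD n] := by
      rw [Nat.modEq_iff_dvd]; push_cast; exact hi
    rw [← Nat.mod_eq_of_lt hyn]; exact this
  have := s3 _ hmem
  omega

theorem leader_half (hn : 1 < n) (hc : Nat.Coprime q n) (ho : Odd n) (hnm : n = q ^ m + 1) {s : ℕ}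
    (hs : s ∈ cosetLeaders q n) : 2 * s < n := by
  obtain ⟨s1, s2, s3⟩ := mem_leaders_s4.1 hs
  rcases Nat.eq_zero_or_pos s with rfl | hs0
  · omega
  have hmem : n - s ∈ cycCoset q n s := by
    rw [mem_cyc hn hc]
    refine ⟨m, ?_⟩
    have : n - s ≡ s * q ^ m [MOD n] := by
      rw [Nat.modEq_iff_dvd]; push_cast [s1.le]
      refine ⟨s - 1, ?_⟩
      have e : (n : ℤ) = (q : ℤ) ^ m + 1 := by rw [hnm]; push_cast; ring
      linear_combination (-s : ℤ) * e
    rw [← Nat.mod_eq_of_lt (show n - s < n by omega)]; exact this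
  have := s3 _ hmem
  obtain ⟨t, ht⟩ := ho
  omega

theorem PP_zero (ho : Odd n) {s : ℕ} (hs : 2 * s < n) : PP q n s 0 (n - 2 * s) := by
  have ho' : Odd (n : ℤ) := by exact_mod_cast ho
  refine ⟨ho'.sub_even (even_two_mul _), by omega, by omega, Or.inr ⟨1, by ring⟩⟩

theorem leader_of (hn : 1 < n) (hc : Nat.Coprime q n) {s : ℕ} (hs : 2 * s < n)
    (H : ∀ j, ∃ Z, PP q n s j Z ∧ Z ≤ n - 2 * s) : s ∈ cosetLeaders q n := by
  refine mem_leaders_s4.2 ⟨by omega, cyc_self hn hc (by omega), ?_⟩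
  intro x hx
  rw [mem_cyc hn hc] at hx
  obtain ⟨j, rfl⟩ := hx
  obtain ⟨Z, ⟨h1, h2, h3, h4⟩, hZ⟩ := H j
  by_contra hlt
  push Not at hlt
  have hmod : (n : ℤ) ∣ s * q ^ j - ((s * q ^ j % n : ℕ) : ℤ) := by
    have := (Nat.modEq_iff_dvd (n := n) (a := s * q ^ j % n) (b := s * q ^ j)).1 (Nat.mod_modEq _ _)
    push_cast at this ⊢; exact this
  generalize s * q ^ j % n = y at *
  obtain ⟨t, ht⟩ := h1
  obtain ⟨d, hd⟩ := hmod
  rcases h4 with ⟨c, hc⟩ | ⟨c, hc⟩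
  · have e : Z - 2 * y = n * (c + 2 * d) := by linear_combination hc + 2 * hd
    have a1 : c + 2 * d < 1 := by by_contra hh; nlinarith
    have a2 : -1 < c + 2 * d := by by_contra hh; nlinarith
    have : c + 2 * d = 0 := by omega
    rw [this] at e; omega
  · have e : Z + 2 * y = n * (c - 2 * d) := by linear_combination hc - 2 * hd
    have a1 : c - 2 * d < 1 := by by_contra hh; nlinarith
    have a2 : -1 < c - 2 * d := by by_contra hh; nlinarith
    have : c - 2 * d = 0 := by omega
    rw [this] at e; omega

/-- Full-size cosets. -/
theorem card_full (hn : 1 < n) (hc : Nat.Coprime q n) (ho : Odd n) (hnm : n = q ^ m + 1)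
    (hm : 0 < m) {s : ℕ} (hs0 : 0 < s) (hs : 2 * s < n)
    (H : ∀ j, 0 < j → j < m → ∃ Z, PP q n s j Z ∧ Z < n - 2 * s) :
    (cycCoset q n s).card = 2 * m := by
  have hcast : ∀ a b : ℕ, a ≡ b [MOD n] ↔ (n : ℤ) ∣ (a : ℤ) - b := fun a b => by
    rw [← Int.natCast_modEq_iff, Int.modEq_comm, Int.modEq_iff_dvd]
  have e : (n : ℤ) = (q : ℤ) ^ m + 1 := by rw [hnm]; push_cast; ring
  have ho' : Odd (n : ℤ) := by exact_mod_cast ho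
  have hn0 : 0 < (n : ℤ) := by omega
  obtain ⟨o1, o2, o3, -⟩ := PP_zero (q := q) ho hs
  have bad : ∀ j, 0 < j → j < m →
      ¬ ((n : ℤ) ∣ (n - 2 * s) - 2 * s * q ^ j ∨ (n : ℤ) ∣ (n - 2 * s) + 2 * s * q ^ j) := by
    intro j h1 h2 h3
    obtain ⟨Z, hZ, hlt⟩ := H j h1 h2
    have := hZ.uniq hn0 ho' ⟨o1, o2, o3, h3⟩
    omega
  apply cyc_card hn hc (by omega)
  · rw [hcast]; push_cast
    refine ⟨s * (q ^ m - 1), ?_⟩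
    rw [two_mul, pow_add]; linear_combination (- s : ℤ) * (q ^ m - 1) * e
  · intro j hj0 hj h
    rw [hcast] at h; push_cast at h
    obtain ⟨c, hc⟩ := h
    rcases lt_trichotomy j m with h' | h' | h'
    · apply bad j hj0 h'
      right; exact ⟨1 + 2 * c, by linear_combination 2 * hc⟩
    · subst h'
      have : (n : ℤ) ∣ 2 * s := ⟨s - c, by linear_combination (-s : ℤ) * e - hc⟩
      have := Int.le_of_dvd (by omega) this
      omega
    · obtain ⟨i, rfl⟩ := Nat.exists_eq_add_of_lt h'
      apply bad (i + 1) (by omega) (by omega)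
      left
      rw [show m + i + 1 = m + (i + 1) by ring, pow_add] at hc
      refine ⟨1 + 2 * c - 2 * s * q ^ (i + 1), ?_⟩
      linear_combination 2 * hc + 2 * (s : ℤ) * q ^ (i + 1) * e

end connect

set_option maxHeartbeats 2000000 in
theorem leaders_info (q m n : ℕ) (hqe : Even q) (hq2 : 2 ≤ q) (hm4 : m % 4 = 2)
    (hnm : n = q ^ m + 1) :
    1 < n ∧ Nat.Coprime q n ∧ Odd n ∧
    ∃ x1 ∈ cosetLeaders q n, 0 < x1 ∧ (∀ s ∈ cosetLeaders q n, s ≤ x1) ∧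
      (cycCoset q n x1).card = 4 ∧
      (m = 2 ∨ ∃ x2 ∈ cosetLeaders q n, 0 < x2 ∧ x2 < x1 ∧
        (∀ s ∈ cosetLeaders q n, s ≤ x2 ∨ s = x1) ∧ (cycCoset q n x2).card = 2 * m) := by
  have hm0 : m ≠ 0 := by rintro rfl; simp at hm4
  have hn1 : 1 < n := by
    have : 0 < q ^ m := by positivity
    omega
  have hc : Nat.Coprime q n := by
    rw [hnm, Nat.coprime_comm]
    obtain ⟨k, rfl⟩ := Nat.exists_eq_succ_of_ne_zero hm0
    rw [Nat.succ_eq_add_one, pow_succ]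
    simp
  have ho : Odd n := by rw [hnm]; exact (hqe.pow_of_ne_zero hm0).add_one
  refine ⟨hn1, hc, ho, ?_⟩
  obtain ⟨K, hK⟩ : ∃ K, m = 4 * K + 2 := ⟨m / 4, by omega⟩
  have hdvd : ∀ K, q ^ 2 + 1 ∣ q ^ (4 * K + 2) + 1 := fun K => by
    have := Odd.nat_add_dvd_pow_add_pow (q ^ 2) 1 (n := 2 * K + 1) (by simp)
    rw [one_pow, ← pow_mul] at this
    convert this using 3; ring
  obtain ⟨h, hnh⟩ : q ^ 2 + 1 ∣ n := by rw [hnm, hK]; exact hdvd K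
  have hh : 0 < h := by
    rcases Nat.eq_zero_or_pos h with rfl | h'
    · omega
    · exact h'
  obtain ⟨r, hr⟩ := hqe
  have zq : Even (q : ℤ) := ⟨r, by exact_mod_cast hr⟩
  have zq2 : (2 : ℤ) ≤ q := by exact_mod_cast hq2
  have zo : Odd (n : ℤ) := by exact_mod_cast ho
  have zh : (0 : ℤ) < h := by exact_mod_cast hh
  have zr : (q : ℤ) = r + r := by exact_mod_cast hr
  have znh : (n : ℤ) = ((q : ℤ) ^ 2 + 1) * h := by exact_mod_cast hnh
  have znm : (n : ℤ) = (q : ℤ) ^ m + 1 := by exact_mod_cast hnm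
  have hnd : ¬ ((q : ℤ) + 1 ∣ n) := by
    intro hd
    have h1 : (q : ℤ) + 1 ∣ (q : ℤ) ^ m - 1 := by
      have h2 := sub_dvd_pow_sub_pow ((q : ℤ) ^ 2) 1 (2 * K + 1)
      rw [one_pow, ← pow_mul, show 2 * (2 * K + 1) = m by omega] at h2
      exact (Dvd.intro ((q : ℤ) - 1) (by ring)).trans h2
    have h2 := dvd_sub hd h1
    rw [znm, show (q : ℤ) ^ m + 1 - ((q : ℤ) ^ m - 1) = 2 by ring] at h2
    have := Int.le_of_dvd (by norm_num) h2
    omega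
  have low : ∀ s ∈ cosetLeaders q n, ((q : ℤ) + 1) * h ≤ n - 2 * s := fun s hs =>
    claimLow zq zq2 zo zh znh hnd (PP_zero ho (leader_half hn1 hc ho hnm hs))
      (leader_HL hn1 hc ho hnm hs)
  have upp : ∀ s ∈ cosetLeaders q n,
      (q : ℤ) ^ 3 * ((n - 2 * s) - (q + 1) * h) < 2 * (q - 1) * h →
      (n : ℤ) - 2 * s = (q + 1) * h := fun s hs hlt => by
    have p0 := PP_zero (q := q) ho (leader_half hn1 hc ho hnm hs)
    have pK := PP_add hnm p0
    rw [zero_add, hK] at pK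
    exact claimU zq zq2 zo zh znh K p0 pK (leader_HL hn1 hc ho hnm hs) (low s hs) hlt
  -- the first leader
  obtain ⟨q', hq'⟩ : ∃ q', q = q' + 1 := ⟨q - 1, by omega⟩
  have zq' : (q' : ℤ) = q - 1 := by rw [hq']; push_cast; ring
  obtain ⟨x1, hx1⟩ : ∃ x1, x1 = r * q' * h := ⟨_, rfl⟩
  have zx1 : (n : ℤ) - 2 * x1 = (q + 1) * h := by
    rw [hx1, znh]; push_cast; rw [zq']; linear_combination ((q : ℤ) - 1) * h * zr
  have x1pos : 0 < x1 := by
    rw [hx1]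
    have : 0 < r := by omega
    have : 0 < q' := by omega
    positivity
  have x1half : 2 * x1 < n := by
    have : (0 : ℤ) < (q + 1) * h := by positivity
    omega
  have x1mem : x1 ∈ cosetLeaders q n := by
    apply leader_of hn1 hc x1half
    rw [zx1]
    apply orbit1 zq zq2 zo zh znh
    rw [← zx1]
    exact PP_zero ho x1half
  refine ⟨x1, x1mem, x1pos, ?_, ?_, ?_⟩
  · intro s hs
    have := low s hs
    omega
  · apply cyc_card4 hn1 hc ho
    · intro hd
      have := Nat.le_of_dvd x1pos hd
      omega
    · exact ⟨r * q', by rw [hnh, hx1]; ring⟩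
  by_cases hm2 : m = 2
  · exact Or.inl hm2
  right
  obtain ⟨K', rfl⟩ : ∃ K', K = K' + 1 := ⟨K - 1, by omega⟩
  obtain ⟨g, hg⟩ := hdvd K'
  have hg0 : 0 < g := by
    rcases Nat.eq_zero_or_pos g with rfl | h'
    · simp at hg
    · exact h'
  have zg0 : (0 : ℤ) < g := by exact_mod_cast hg0
  have zg : ((q : ℤ) ^ 2 + 1) * g = (q : ℤ) ^ (4 * K' + 2) + 1 := by exact_mod_cast hg.symm
  have zhg : (h : ℤ) = (q : ℤ) ^ 4 * g - (q ^ 2 - 1) := by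
    have hne : ((q : ℤ) ^ 2 + 1) ≠ 0 := by positivity
    apply mul_left_cancel₀ hne
    rw [← znh, znm, hK]
    have : (q : ℤ) ^ (4 * (K' + 1) + 2) = q ^ 4 * q ^ (4 * K' + 2) := by ring
    rw [this]; linear_combination (- (q : ℤ) ^ 4) * zg
  have hgh : 2 * (g : ℤ) < h := by
    have h4 : (4 : ℤ) ≤ (q : ℤ) ^ 2 := by nlinarith
    have : (q : ℤ) ^ 2 * 4 * g ≤ q ^ 2 * q ^ 2 * g := by gcongr
    nlinarith [mul_nonneg (sq_nonneg (q : ℤ)) (by linarith : (0 : ℤ) ≤ g - 1)]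
  obtain ⟨x2, hx2⟩ : ∃ x2 : ℕ, (x2 : ℤ) = (q - 1) * (r * h - q * g) := by
    have hr0 : (0 : ℤ) ≤ r := by positivity
    exact ⟨((q - 1) * (r * h - q * g) : ℤ).toNat,
      Int.toNat_of_nonneg (mul_nonneg (by linarith) (by rw [zr]; nlinarith))⟩
  have zx2 : (n : ℤ) - 2 * x2 = (q + 1) * h + 2 * q * (q - 1) * g := by
    rw [hx2, znh]; linear_combination ((q : ℤ) - 1) * h * zr
  have hx2pos : 0 < x2 := by
    have hr0 : (0 : ℤ) < r := by omega
    have : (0 : ℤ) < x2 := by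
      rw [hx2]
      exact mul_pos (by linarith) (by rw [zr]; nlinarith)
    exact_mod_cast this
  have hgap : 0 < 2 * (q : ℤ) * (q - 1) * g := by
    have : (0 : ℤ) < q - 1 := by linarith
    positivity
  have x2lt : x2 < x1 := by omega
  have x2half : 2 * x2 < n := by omega
  have orb : ∀ j, 0 < j → j < m → ∃ Z, PP q n x2 j Z ∧ Z < n - 2 * x2 := by
    intro j hj0 hj
    rw [zx2]
    apply orbit2 zq zq2 zo zh zg0 znh zhg K' zg _ j hj0 (by omega)
    rw [← zx2]
    exact PP_zero ho x2half
  refine ⟨x2, ?_, hx2pos, x2lt, ?_, card_full hn1 hc ho hnm (by omega) hx2pos x2half orb⟩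
  · apply leader_of hn1 hc x2half
    intro j
    have hj : j = j % m + m * (j / m) := (Nat.mod_add_div j m).symm
    have hlt : j % m < m := Nat.mod_lt _ (by omega)
    rw [hj]
    rcases Nat.eq_zero_or_pos (j % m) with h0 | h0
    · rw [h0]
      exact ⟨_, PP_add_mul hnm (PP_zero ho x2half) _, le_rfl⟩
    · obtain ⟨Z, hZ, hl⟩ := orb _ h0 hlt
      exact ⟨Z, PP_add_mul hnm hZ _, hl.le⟩
  · intro s hs
    by_cases hle : s ≤ x2
    · exact Or.inl hle
    right
    have := upp s hs (by
      have h1 : (n : ℤ) - 2 * s - (q + 1) * h ≤ 2 * q * (q - 1) * g - 2 := by omega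
      have h2 : (q : ℤ) ^ 3 * (n - 2 * s - (q + 1) * h) ≤ q ^ 3 * (2 * q * (q - 1) * g - 2) := by
        gcongr
      have h3 : (q : ℤ) ^ 4 * g = h + (q ^ 2 - 1) := by linarith
      have h4 : (q : ℤ) ^ 3 * (2 * q * (q - 1) * g - 2)
        = 2 * (q - 1) * h + 2 * (q - 1) * (q ^ 2 - 1) - 2 * q ^ 3 := by
        linear_combination 2 * ((q : ℤ) - 1) * h3
      have h5 : 2 * ((q : ℤ) - 1) * (q ^ 2 - 1) - 2 * q ^ 3 < 0 := by
        have e : 2 * ((q : ℤ) - 1) * (q ^ 2 - 1) - 2 * q ^ 3 = 2 * (1 - q - q ^ 2) := by ring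
        rw [e]
        have := sq_nonneg (q : ℤ)
        linarith
      linarith)
    omega

/-- for even prime power `q`, `m ≡ 2 (mod 4)`, `m ≥ 2`, `n = q^m+1`:
if `δ_{2,n}+1 ≤ δ ≤ δ_{1,n}` then `|C_1 ∪ ⋯ ∪ C_{δ-1}| = n - 5`;
if `δ_{3,n}+1 ≤ δ ≤ δ_{2,n}` then `|C_1 ∪ ⋯ ∪ C_{δ-1}| = n - (2m+5)`. -/
theorem stmt_4 (q m n : ℕ) (hq : ∃ e : ℕ, 0 < e ∧ q = 2 ^ e)
    (hm4 : m % 4 = 2) (hm : 2 ≤ m) (hn : n = q ^ m + 1) (δ : ℕ) :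
    (nthLargestCosetLeader q n 2 + 1 ≤ δ → δ ≤ nthLargestCosetLeader q n 1 →
      ((Finset.Icc 1 (δ - 1)).biUnion (cycCoset q n)).card = n - 5) ∧
    (nthLargestCosetLeader q n 3 + 1 ≤ δ → δ ≤ nthLargestCosetLeader q n 2 →
      ((Finset.Icc 1 (δ - 1)).biUnion (cycCoset q n)).card = n - (2 * m + 5)) := by
  obtain ⟨e, he0, he⟩ := hq
  have hqe : Even q := by rw [he]; exact even_two.pow_of_ne_zero (by omega)
  have hq2 : 2 ≤ q := by rw [he]; exact Nat.le_self_pow (by omega) 2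
  obtain ⟨hn1, hc, ho, x1, x1mem, x1pos, x1max, x1card, hx2⟩ :=
    leaders_info q m n hqe hq2 hm4 hn
  unfold nthLargestCosetLeader
  obtain ⟨l, hl⟩ : ∃ l, l = ((cosetLeaders q n).sort (· ≤ ·)).reverse := ⟨_, rfl⟩
  obtain ⟨hpw, hmem⟩ := list_facts _ l hl
  rw [← hl]
  have hz := (hmem 0).2 (zero_leader hn1 hc)
  have hltn : ∀ s ∈ cosetLeaders q n, s < n := fun s hs => (mem_leaders_s4.1 hs).1
  have hdisj : ∀ S ⊆ cosetLeaders q n,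
      (S.biUnion (cycCoset q n)).card = ∑ s ∈ S, (cycCoset q n s).card := by
    intro S hS
    apply Finset.card_biUnion
    intro a ha b hb hab
    refine Finset.disjoint_left.2 ?_
    intro x hxa hxb
    exact hab (leader_uniq hn1 hc (hS ha) (hS hb) hxa hxb)
  have hx1l := (hmem x1).2 x1mem
  match l, hpw, hmem, hz, hx1l with
  | [], _, _, hz, _ => simp at hz
  | [a], _, _, hz, hx => simp at hz hx; omega
  | a :: b :: t, hpw, hmem, hz, hx =>
    have ha : a = x1 := by
      have h1 := x1max a ((hmem a).1 (by simp))
      rcases List.mem_cons.1 hx with h | h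
      · exact h.symm
      · have := (List.pairwise_cons.1 hpw).1 _ h
        omega
    subst ha
    have hpa := (List.pairwise_cons.1 hpw).1
    have hpb := (List.pairwise_cons.1 (List.pairwise_cons.1 hpw).2).1
    have hab : b < a := hpa b (by simp)
    have han := hltn a x1mem
    have hbmem : b ∈ cosetLeaders q n := (hmem b).1 (by simp)
    simp only [Nat.sub_self, List.getD_cons_zero, show 2 - 1 = 1 from rfl,
      show 3 - 1 = 2 from rfl, List.getD_cons_succ]
    constructor
    · intro h1 h2
      have hu := union_card hn1 hc δ (by omega) (by omega)
      have hS : ((cosetLeaders q n).filter fun s => s = 0 ∨ δ ≤ s) = {0, a} := by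
        ext s
        simp only [Finset.mem_filter, Finset.mem_insert, Finset.mem_singleton]
        constructor
        · rintro ⟨hs, rfl | hs'⟩
          · exact Or.inl rfl
          · right
            rcases List.mem_cons.1 ((hmem s).2 hs) with h | h
            · exact h
            · rcases List.mem_cons.1 h with h | h
              · omega
              · have := hpb _ h
                omega
        · rintro (rfl | rfl)
          · exact ⟨zero_leader hn1 hc, Or.inl rfl⟩
          · exact ⟨x1mem, Or.inr h2⟩
      rw [hdisj _ (Finset.filter_subset _ _), hS, Finset.sum_pair (by omega), x1card,
        cyc_zero hn1 hc, Finset.card_singleton] at hu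
      omega
    · intro h1 h2
      have hb0 : 0 < b := by omega
      have hbcard : (cycCoset q n b).card = 2 * m := by
        rcases hx2 with rfl | ⟨x2, x2mem, x2pos, x2lt, x2max, x2card⟩
        · apply cyc_card4 hn1 hc ho
          · intro hd
            have := Nat.le_of_dvd hb0 hd
            omega
          · rw [← hn]; exact Dvd.intro_left _ rfl
        · have : b = x2 := by
            have h3 := x2max b hbmem
            rcases List.mem_cons.1 ((hmem x2).2 x2mem) with h | h
            · omega
            · rcases List.mem_cons.1 h with h | h
              · exact h.symm
              · have := hpb _ h
                omega
          rw [this]; exact x2card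
      have hu := union_card hn1 hc δ (by omega) (by omega)
      have hS : ((cosetLeaders q n).filter fun s => s = 0 ∨ δ ≤ s) = {0, a, b} := by
        ext s
        simp only [Finset.mem_filter, Finset.mem_insert, Finset.mem_singleton]
        constructor
        · rintro ⟨hs, rfl | hs'⟩
          · exact Or.inl rfl
          · right
            rcases List.mem_cons.1 ((hmem s).2 hs) with h | h
            · exact Or.inl h
            · rcases List.mem_cons.1 h with h | h
              · exact Or.inr h
              · exfalso
                match t, h, hpw, h1 with
                | c :: t', h, hpw, h1 =>
                  simp only [List.getD_cons_zero] at h1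
                  have hpc := (List.pairwise_cons.1
                    (List.pairwise_cons.1 (List.pairwise_cons.1 hpw).2).2).1
                  rcases List.mem_cons.1 h with h | h
                  · omega
                  · have := hpc _ h
                    omega
        · rintro (rfl | rfl | rfl)
          · exact ⟨zero_leader hn1 hc, Or.inl rfl⟩
          · exact ⟨x1mem, Or.inr (by omega)⟩
          · exact ⟨hbmem, Or.inr h2⟩
      rw [hdisj _ (Finset.filter_subset _ _), hS, Finset.sum_insert (by simp; omega),
        Finset.sum_pair (by omega), x1card, hbcard, cyc_zero hn1 hc,
        Finset.card_singleton] at hu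
      omega
end
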